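/- arXiv:0806.0492 — 2 statements merged into one kernel-verified Lean document; each statement's English description precedes it below -/
import Mathlib

section
/- Let f ∈ C¹(ℝ) with f'(0) > 0, and suppose that u = 0 is the only bounded stable C² solution of −Δu = f(u) in ℝ^N. Then there exists no bounded C² solution of −Δu = f(u) in ℝ^N which is stable outside a compact set. -/
open MeasureTheory Filter Topology
open scoped ENNReal

/-- The Laplacian of `u : ℝ^N → ℝ`. -/
noncomputable def lap {N : ℕ} (u : EuclideanSpace ℝ (Fin N) → ℝ)
    (x : EuclideanSpace ℝ (Fin N)) : ℝ :=
  ∑ i : Fin N, iteratedFDeriv ℝ 2 u x ![EuclideanSpace.single i 1, EuclideanSpace.single i 1]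

/-- `u` is a stable solution w.r.t. the linearized weight `g = f'`:
`∫ f'(u) φ² ≤ ∫ |∇φ|²` for all `φ ∈ C¹_c(ℝ^N)`. -/
def Stable {N : ℕ} (g : ℝ → ℝ) (u : EuclideanSpace ℝ (Fin N) → ℝ) : Prop :=
  ∀ φ : EuclideanSpace ℝ (Fin N) → ℝ, ContDiff ℝ 1 φ → HasCompactSupport φ →
    ∫ x, g (u x) * (φ x) ^ 2 ≤ ∫ x, ‖gradient φ x‖ ^ 2

/-- `u` is stable outside the set `K` : the stability inequality holds for all
`φ ∈ C¹_c(ℝ^N \ K)`. -/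
def StableOutside {N : ℕ} (g : ℝ → ℝ) (u : EuclideanSpace ℝ (Fin N) → ℝ)
    (K : Set (EuclideanSpace ℝ (Fin N))) : Prop :=
  ∀ φ : EuclideanSpace ℝ (Fin N) → ℝ, ContDiff ℝ 1 φ → HasCompactSupport φ →
    tsupport φ ⊆ Kᶜ →
    ∫ x, g (u x) * (φ x) ^ 2 ≤ ∫ x, ‖gradient φ x‖ ^ 2

/-- The quantity `q(u) = f'(u)²/(f(u) f''(u)) ∈ [0,∞]`, with the convention
`q(u) = +∞` when `f(u) f''(u) = 0`. -/
noncomputable def qfun (f : ℝ → ℝ) (t : ℝ) : ℝ≥0∞ :=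
  if f t * deriv (deriv f) t = 0 then ⊤
  else ENNReal.ofReal ((deriv f t) ^ 2 / (f t * deriv (deriv f) t))

/-- The Joseph–Lundgren exponent `p_c(N)` (for `N ≥ 11`). -/
noncomputable def pc (N : ℕ) : ℝ :=
  (((N : ℝ) - 2) ^ 2 - 4 * N + 8 * Real.sqrt ((N : ℝ) - 1)) / (((N : ℝ) - 2) * ((N : ℝ) - 10))

set_option linter.unusedSectionVars false

section ParametricIntegral

variable {X P V : Type*} [NormedAddCommGroup X] [NormedSpace ℝ X] [ProperSpace X]
  [TopologicalSpace P] [T2Space P] [MeasurableSpace P]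
  [OpensMeasurableSpace P]
  [NormedAddCommGroup V] [NormedSpace ℝ V] {μ : Measure P} [IsLocallyFiniteMeasure μ]

/-- Differentiation under the integral sign over a compact set. -/
lemma hasFDerivAt_setIntegral_of_continuous {F : X → P → V} {F' : X → P → X →L[ℝ] V}
    (hF : ∀ x, Continuous (F x)) (hF' : Continuous F'.uncurry)
    (hd : ∀ x p, HasFDerivAt (F · p) (F' x p) x) {K : Set P} (hK : IsCompact K) (x₀ : X) :
    HasFDerivAt (fun x => ∫ p in K, F x p ∂μ) (∫ p in K, F' x₀ p ∂μ) x₀ := by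
  obtain ⟨C, hC⟩ := ((isCompact_closedBall x₀ 1).prod hK).exists_bound_of_continuousOn
    hF'.continuousOn
  have : IsFiniteMeasure (μ.restrict K) := ⟨by simpa using hK.measure_lt_top⟩
  refine hasFDerivAt_integral_of_dominated_of_fderiv_le (bound := fun _ => C)
    (Metric.ball_mem_nhds x₀ one_pos) ?_ ?_ ?_ ?_ (integrable_const _) ?_
  · exact .of_forall fun x => (hF x).continuousOn.aestronglyMeasurable_of_isCompact hK
      hK.measurableSet
  · exact (hF x₀).continuousOn.integrableOn_compact hK
  · exact (hF'.comp (by fun_prop : Continuous fun p => (x₀, p))).continuousOn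
      |>.aestronglyMeasurable_of_isCompact hK hK.measurableSet
  · filter_upwards [ae_restrict_mem hK.measurableSet] with p hp x hx
    exact hC (x, p) ⟨Metric.ball_subset_closedBall hx, hp⟩
  · exact .of_forall fun p x _ => hd x p

variable [SecondCountableTopology P]

/-- The average of the translates of `g` by `s p`, `p ∈ K`, against the weight `w`. -/
noncomputable def translateAverage (μ : Measure P) (K : Set P) (s : P → X) (w : P → V)
    (g : X → ℝ) (x : X) : V :=
  ∫ p in K, g (x + s p) • w p ∂μ

variable {K : Set P} {s : P → X} {w : P → V} {g : X → ℝ}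

lemma continuous_translateAverage (hK : IsCompact K) (hs : Continuous s) (hw : Continuous w)
    (hg : Continuous g) : Continuous (translateAverage μ K s w g) := by
  refine continuous_parametric_integral_of_continuous (μ := μ)
    (f := fun x p => g (x + s p) • w p) ?_ hK
  simp only [Function.uncurry_def]
  fun_prop

lemma integrableOn_translateAverage (hK : IsCompact K) (hs : Continuous s) (hw : Continuous w)
    (hg : Continuous g) (x : X) : IntegrableOn (fun p => g (x + s p) • w p) K μ :=
  ContinuousOn.integrableOn_compact hK (by fun_prop)

lemma hasFDerivAt_translateAverage (hK : IsCompact K) (hs : Continuous s) (hw : Continuous w)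
    (hg : ContDiff ℝ 1 g) (x : X) :
    HasFDerivAt (translateAverage μ K s w g)
      (∫ p in K, (fderiv ℝ g (x + s p)).smulRight (w p) ∂μ) x := by
  have hg' := hg.continuous_fderiv one_ne_zero
  have hgc := hg.continuous
  refine hasFDerivAt_setIntegral_of_continuous (F := fun x p => g (x + s p) • w p)
    (F' := fun x p => (fderiv ℝ g (x + s p)).smulRight (w p))
    (fun x => by fun_prop) ?_ (fun x p => ?_) hK x
  · simp only [Function.uncurry_def]
    fun_prop
  · refine HasFDerivAt.smul_const (c := fun x => g (x + s p)) ?_ (w p)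
    exact (hasFDerivAt_comp_add_right (s p)).2 (hg.differentiable one_ne_zero _).hasFDerivAt

lemma contDiff_translateAverage (hK : IsCompact K) (hs : Continuous s) (hw : Continuous w)
    (hg : ContDiff ℝ 1 g) : ContDiff ℝ 1 (translateAverage μ K s w g) := by
  have hg' := hg.continuous_fderiv one_ne_zero
  rw [contDiff_one_iff_hasFDerivAt]
  refine ⟨_, ?_, hasFDerivAt_translateAverage hK hs hw hg⟩
  refine continuous_parametric_integral_of_continuous (μ := μ)
    (f := fun x p => (fderiv ℝ g (x + s p)).smulRight (w p)) ?_ hK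
  simp only [Function.uncurry_def]
  fun_prop

lemma fderiv_translateAverage_apply [CompleteSpace V] (hK : IsCompact K) (hs : Continuous s)
    (hw : Continuous w) (hg : ContDiff ℝ 1 g) (x e : X) :
    fderiv ℝ (translateAverage μ K s w g) x e =
      translateAverage μ K s w (fun z => fderiv ℝ g z e) x := by
  have hg' := hg.continuous_fderiv one_ne_zero
  rw [(hasFDerivAt_translateAverage hK hs hw hg x).fderiv, ContinuousLinearMap.integral_apply]
  · rfl
  · have : Continuous fun p => (fderiv ℝ g (x + s p)).smulRight (w p) := by fun_prop
    exact this.continuousOn.integrableOn_compact hK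

lemma exists_norm_translateAverage_le (hK : IsCompact K) (hw : Continuous w) :
    ∃ C, 0 ≤ C ∧ ∀ (g : X → ℝ) (M : ℝ) (x : X), (∀ p ∈ K, |g (x + s p)| ≤ M) →
      ‖translateAverage μ K s w g x‖ ≤ M * C := by
  obtain ⟨C, hC⟩ := hK.exists_bound_of_continuousOn hw.continuousOn
  refine ⟨|C| * μ.real K, by positivity, fun g M x hg => ?_⟩
  rw [← mul_assoc]
  refine norm_setIntegral_le_of_norm_le_const hK.measure_lt_top fun p hp => ?_
  rw [norm_smul, Real.norm_eq_abs]
  have := abs_nonneg (g (x + s p))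
  exact mul_le_mul (hg p hp) ((hC p hp).trans (le_abs_self _)) (norm_nonneg _)
    (this.trans (hg p hp))

lemma translateAverage_sub (hK : IsCompact K) (hs : Continuous s) (hw : Continuous w)
    {g h : X → ℝ} (hg : Continuous g) (hh : Continuous h) (x : X) :
    translateAverage μ K s w g x - translateAverage μ K s w h x =
      translateAverage μ K s w (g - h) x := by
  rw [translateAverage, translateAverage, ← integral_sub
    (integrableOn_translateAverage hK hs hw hg x) (integrableOn_translateAverage hK hs hw hh x)]
  simp only [translateAverage, Pi.sub_apply, sub_smul]

lemma tendstoLocallyUniformly_translateAverage (hK : IsCompact K) (hs : Continuous s)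
    (hw : Continuous w) {g : ℕ → X → ℝ} {h : X → ℝ} (hg : ∀ n, Continuous (g n))
    (hh : Continuous h) (hgh : TendstoLocallyUniformly g h atTop) :
    TendstoLocallyUniformly (fun n => translateAverage μ K s w (g n))
      (translateAverage μ K s w h) atTop := by
  obtain ⟨C, hC0, hC⟩ := exists_norm_translateAverage_le (s := s) (μ := μ) hK hw
  rw [tendstoLocallyUniformly_iff_forall_isCompact] at hgh ⊢
  intro L hL
  have hL' : IsCompact (Set.image (fun q : X × P => q.1 + s q.2) (L ×ˢ K)) :=
    (hL.prod hK).image (by fun_prop)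
  have h1 := hgh _ hL'
  rw [Metric.tendstoUniformlyOn_iff] at h1 ⊢
  intro ε hε
  filter_upwards [h1 (ε / (C + 1)) (by positivity)] with n hn x hx
  rw [dist_eq_norm, translateAverage_sub hK hs hw hh (hg n)]
  refine (hC _ (ε / (C + 1)) x fun p hp => ?_).trans_lt ?_
  · exact (hn _ ⟨(x, p), ⟨hx, hp⟩, rfl⟩).le
  · rw [div_mul_eq_mul_div, div_lt_iff₀ (by positivity)]
    nlinarith

lemma tendsto_translateAverage_of_bounded (hK : IsCompact K) (hs : Continuous s)
    (hw : Continuous w) {g : ℕ → X → ℝ} {h : X → ℝ} (hg : ∀ n, Continuous (g n)) {M : ℝ}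
    (hM : ∀ n x, |g n x| ≤ M) (hgh : ∀ x, Tendsto (fun n => g n x) atTop (𝓝 (h x))) (x : X) :
    Tendsto (fun n => translateAverage μ K s w (g n) x) atTop
      (𝓝 (translateAverage μ K s w h x)) := by
  refine tendsto_integral_of_dominated_convergence (fun p => M * ‖w p‖)
    (fun n => (integrableOn_translateAverage hK hs hw (hg n) x).aestronglyMeasurable) ?_ ?_ ?_
  · exact ContinuousOn.integrableOn_compact hK (by fun_prop)
  · refine fun n => .of_forall fun p => ?_
    rw [norm_smul]
    exact mul_le_mul_of_nonneg_right (hM n _) (norm_nonneg _)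
  · exact .of_forall fun p => (hgh _).smul_const _

end ParametricIntegral

section Kernel

lemma hasDerivAt_max_zero_pow (n : ℕ) (s : ℝ) :
    HasDerivAt (fun s : ℝ => (max s 0) ^ (n + 2)) ((n + 2) * (max s 0) ^ (n + 1)) s := by
  rcases lt_trichotomy s 0 with h | rfl | h
  · have h1 : (fun s : ℝ => (max s 0) ^ (n + 2)) =ᶠ[𝓝 s] fun _ => 0 := by
      filter_upwards [gt_mem_nhds h] with r hr
      simp [max_eq_right hr.le]
    simpa [max_eq_right h.le] using (hasDerivAt_const s (0 : ℝ)).congr_of_eventuallyEq h1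
  · rw [hasDerivAt_iff_isLittleO]
    simp only [max_self, sub_zero, smul_eq_mul, ne_eq, Nat.add_eq_zero_iff, OfNat.ofNat_ne_zero,
      one_ne_zero, and_false, not_false_eq_true, zero_pow, mul_zero]
    have h2 : (fun r : ℝ => r ^ (n + 2)) =o[𝓝 0] fun r => r := by
      simpa using Asymptotics.isLittleO_pow_pow (𝕜 := ℝ) (show 1 < n + 2 by lia)
    refine Asymptotics.IsBigO.trans_isLittleO (Asymptotics.IsBigO.of_bound 1 ?_) h2
    refine .of_forall fun r => ?_
    rw [norm_pow, norm_pow, one_mul]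
    refine pow_le_pow_left₀ (norm_nonneg _) ?_ _
    rw [Real.norm_eq_abs, Real.norm_eq_abs, abs_of_nonneg (le_max_right _ _)]
    exact max_le (le_abs_self r) (abs_nonneg r)
  · have h1 : (fun s : ℝ => (max s 0) ^ (n + 2)) =ᶠ[𝓝 s] fun s => s ^ (n + 2) := by
      filter_upwards [lt_mem_nhds h] with r hr
      simp [max_eq_left hr.le]
    simpa [max_eq_left h.le] using (hasDerivAt_pow (n + 2) s).congr_of_eventuallyEq h1

variable {E : Type*} [NormedAddCommGroup E] [InnerProductSpace ℝ E]

/-- The truncated paraboloid raised to the power `n`, a kernel of class `C^(n-1)` supported in the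
closed unit ball. -/
noncomputable def ballKernel (n : ℕ) (y : E) : ℝ := (max (1 - ‖y‖ ^ 2) 0) ^ n

lemma continuous_ballKernel (n : ℕ) : Continuous (ballKernel n : E → ℝ) := by
  unfold ballKernel
  fun_prop

lemma hasFDerivAt_ballKernel (n : ℕ) (y : E) :
    HasFDerivAt (ballKernel (n + 2))
      ((-(2 * (n + 2)) * ballKernel (n + 1) y : ℝ) • innerSL ℝ y) y := by
  have h1 : HasFDerivAt (fun y : E => 1 - ‖y‖ ^ 2) (-(2 • innerSL ℝ y)) y :=
    (hasStrictFDerivAt_norm_sq y).hasFDerivAt.const_sub 1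
  refine ((hasDerivAt_max_zero_pow n _).comp_hasFDerivAt y h1).congr_fderiv ?_
  ext z
  simp [ballKernel]
  ring

lemma fderiv_ballKernel_apply (n : ℕ) (y e : E) :
    fderiv ℝ (ballKernel (n + 2)) y e =
      -(2 * (n + 2)) * ballKernel (n + 1) y * inner ℝ y e := by
  simp [(hasFDerivAt_ballKernel n y).fderiv]

lemma contDiff_ballKernel (n : ℕ) : ContDiff ℝ 1 (ballKernel (n + 2) : E → ℝ) := by
  rw [contDiff_one_iff_hasFDerivAt]
  refine ⟨_, ?_, hasFDerivAt_ballKernel n⟩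
  have := continuous_ballKernel (E := E) (n + 1)
  fun_prop

lemma ballKernel_eq_zero (n : ℕ) {y : E} (hy : y ∉ Metric.closedBall 0 1) :
    ballKernel (n + 1) y = 0 := by
  have : 1 < ‖y‖ := by simpa using hy
  have : 1 - ‖y‖ ^ 2 ≤ 0 := by nlinarith
  simp [ballKernel, max_eq_right this]

lemma ballKernel_nonneg (n : ℕ) (y : E) : 0 ≤ ballKernel n y :=
  pow_nonneg (le_max_right _ _) n

variable [FiniteDimensional ℝ E]

lemma hasCompactSupport_ballKernel (n : ℕ) : HasCompactSupport (ballKernel (n + 1) : E → ℝ) :=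
  HasCompactSupport.intro (isCompact_closedBall 0 1) fun _ hy => ballKernel_eq_zero n hy

variable [MeasurableSpace E] [BorelSpace E]

lemma integral_ballKernel_pos (n : ℕ) (μ : Measure E) [μ.IsOpenPosMeasure]
    [IsLocallyFiniteMeasure μ] :
    0 < ∫ y, ballKernel (n + 1) y ∂μ := by
  refine (continuous_ballKernel (n + 1)).integral_pos_of_hasCompactSupport_nonneg_nonzero
    (hasCompactSupport_ballKernel n) (ballKernel_nonneg (n + 1)) (x := 0) ?_
  simp [ballKernel]

/-- Integration by parts against a kernel supported in the closed unit ball. -/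
lemma setIntegral_mul_fderiv_kernel {μ : Measure E} [μ.IsAddHaarMeasure] {κ g : E → ℝ}
    (hκ : ContDiff ℝ 1 κ) (hsupp : ∀ y ∉ Metric.closedBall 0 1, κ y = 0)
    (hg : ContDiff ℝ 1 g) (x e : E) (t : ℝ) :
    ∫ y in Metric.closedBall 0 1, g (x + t • y) * fderiv ℝ κ y e ∂μ =
      -∫ y in Metric.closedBall 0 1, t * fderiv ℝ g (x + t • y) e * κ y ∂μ := by
  have hcs : HasCompactSupport κ := HasCompactSupport.intro (isCompact_closedBall 0 1) hsupp
  have hκ' := hκ.continuous_fderiv one_ne_zero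
  have hκc := hκ.continuous
  have hg' := hg.continuous_fderiv one_ne_zero
  have hgc := hg.continuous
  have hd : ∀ y, HasFDerivAt (fun y => g (x + t • y)) (t • fderiv ℝ g (x + t • y)) y := fun y => by
    have h1 : HasFDerivAt (fun y : E => x + t • y) (t • ContinuousLinearMap.id ℝ E) y :=
      ((hasFDerivAt_id y).const_smul t).const_add x
    refine ((hg.differentiable one_ne_zero _).hasFDerivAt.comp y h1).congr_fderiv ?_
    ext z
    simp
  have hfd : ∀ y, fderiv ℝ (fun y => g (x + t • y)) y e = t * fderiv ℝ g (x + t • y) e :=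
    fun y => by simp [(hd y).fderiv]
  have hz : ∀ y ∉ Metric.closedBall (0 : E) 1, fderiv ℝ κ y e = 0 := fun y hy => by
    have : y ∉ tsupport κ := fun h => hy <| closure_minimal
      (fun z hz => by_contra fun h => Function.mem_support.1 hz (hsupp z h))
      Metric.isClosed_closedBall h
    have := (fderiv_of_notMem_tsupport (𝕜 := ℝ) this)
    simp [this]
  rw [setIntegral_eq_integral_of_forall_compl_eq_zero fun y hy => by rw [hz y hy, mul_zero],
    setIntegral_eq_integral_of_forall_compl_eq_zero fun y hy => by rw [hsupp y hy, mul_zero]]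
  simp_rw [← hfd]
  refine integral_mul_fderiv_eq_neg_fderiv_mul_of_integrable ?_ ?_ ?_
    (fun y _ => (hd y).differentiableAt) (fun y _ => hκ.differentiable one_ne_zero y)
  · simp_rw [hfd]
    exact Continuous.integrable_of_hasCompactSupport (by fun_prop) hcs.mul_left
  · exact Continuous.integrable_of_hasCompactSupport (by fun_prop)
      (hcs.fderiv_apply ℝ e).mul_left
  · exact Continuous.integrable_of_hasCompactSupport (by fun_prop) hcs.mul_left

end Kernel

section Representation

/-- The Euclidean space `ℝ^N`. -/
abbrev 𝔼 (N : ℕ) : Type := EuclideanSpace ℝ (Fin N)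

variable {N : ℕ}

lemma lap_eq_sum_fderiv {u : (𝔼 N) → ℝ} (hu : ContDiff ℝ 2 u) (x : 𝔼 N) :
    lap u x = ∑ i, fderiv ℝ (fun z => fderiv ℝ u z (EuclideanSpace.single i 1)) x
      (EuclideanSpace.single i 1) := by
  have hd : Differentiable ℝ (fderiv ℝ u) :=
    (hu.fderiv_right (m := 1) (by norm_num)).differentiable one_ne_zero
  refine Finset.sum_congr rfl fun i _ => ?_
  rw [iteratedFDeriv_two_apply, fderiv_clm_apply (hd x) (differentiableAt_const _)]
  simp

lemma contDiff_fderiv_apply {u : (𝔼 N) → ℝ} (hu : ContDiff ℝ 2 u) (e : 𝔼 N) :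
    ContDiff ℝ 1 fun z => fderiv ℝ u z e :=
  (hu.fderiv_right (m := 1) (by norm_num)).clm_apply contDiff_const

lemma continuous_lap {u : (𝔼 N) → ℝ} (hu : ContDiff ℝ 2 u) : Continuous (lap u) := by
  rw [funext (lap_eq_sum_fderiv hu)]
  refine continuous_finsetSum _ fun i _ => ?_
  exact ((contDiff_fderiv_apply hu _).continuous_fderiv one_ne_zero).clm_apply continuous_const

/-- The derivative of weighted ball averages with respect to the radius. -/
lemma hasDerivAt_ballAverage {u : (𝔼 N) → ℝ} (hu : ContDiff ℝ 2 u) (x : 𝔼 N) (t : ℝ) :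
    HasDerivAt (fun t : ℝ => ∫ y in Metric.closedBall 0 1, u (x + t • y) * ballKernel 2 y)
      (∫ y in Metric.closedBall 0 1, lap u (x + t • y) * (t / 6 * ballKernel 3 y)) t := by
  have hu1 : ContDiff ℝ 1 u := hu.of_le (by norm_num)
  have huc := hu.continuous
  have hu' := hu1.continuous_fderiv one_ne_zero
  have hlap := continuous_lap hu
  have hk2 := continuous_ballKernel (E := 𝔼 N) 2
  have hk3 := continuous_ballKernel (E := 𝔼 N) 3
  have hB := isCompact_closedBall (0 : 𝔼 N) 1
  have h1 := (hasFDerivAt_setIntegral_of_continuous (μ := volume)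
    (F := fun (t : ℝ) (y : 𝔼 N) => u (x + t • y) * ballKernel 2 y)
    (F' := fun t y => ContinuousLinearMap.toSpanSingleton ℝ
      (fderiv ℝ u (x + t • y) y * ballKernel 2 y))
    (fun t => by fun_prop) (by
      simp only [Function.uncurry_def]
      have := (ContinuousLinearMap.toSpanSingletonCLE (𝕜 := ℝ) (E := ℝ)).continuous
      exact this.comp (by fun_prop))
    (fun t y => by
      have h2 : HasDerivAt (fun t : ℝ => x + t • y) y t := by
        simpa using ((hasDerivAt_id t).smul_const y).const_add x
      exact ((hu1.differentiable one_ne_zero _).hasFDerivAt.comp_hasDerivAt t h2).mul_const _)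
    hB t).hasDerivAt
  convert! h1 using 1
  rw [ContinuousLinearMap.integral_apply]
  · simp only [ContinuousLinearMap.toSpanSingleton_apply, one_smul]
    have h3 : ∀ y : 𝔼 N, fderiv ℝ u (x + t • y) y * ballKernel 2 y =
        ∑ i, -(1 / 6) * (fderiv ℝ u (x + t • y) (EuclideanSpace.single i 1) *
          fderiv ℝ (ballKernel 3) y (EuclideanSpace.single i 1)) := fun y => by
      have hy : y = ∑ i, y i • EuclideanSpace.single i (1 : ℝ) := by
        simpa using ((EuclideanSpace.basisFun (Fin N) ℝ).sum_repr y).symm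
      conv_lhs => rw [hy, map_sum, ← hy]
      rw [Finset.sum_mul]
      refine Finset.sum_congr rfl fun i _ => ?_
      rw [fderiv_ballKernel_apply 1]
      simp [EuclideanSpace.inner_single_right]
      ring
    simp_rw [h3]
    have hi : ∀ i : Fin N, IntegrableOn (fun y : 𝔼 N => -(1 / 6 : ℝ) *
        (fderiv ℝ u (x + t • y) (EuclideanSpace.single i 1) *
          fderiv ℝ (ballKernel 3) y (EuclideanSpace.single i 1))) (Metric.closedBall 0 1) := by
      intro i
      have := (contDiff_ballKernel (E := 𝔼 N) 1).continuous_fderiv one_ne_zero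
      exact ContinuousOn.integrableOn_compact hB (by fun_prop)
    rw [integral_finsetSum _ fun i _ => hi i]
    simp_rw [integral_const_mul, setIntegral_mul_fderiv_kernel (contDiff_ballKernel 1)
      (fun y hy => ballKernel_eq_zero 2 hy) (contDiff_fderiv_apply hu _),
      ← integral_neg, ← integral_const_mul]
    rw [← integral_finsetSum]
    · refine integral_congr_ae (.of_forall fun y => ?_)
      simp only [lap_eq_sum_fderiv hu, Finset.sum_mul]
      refine Finset.sum_congr rfl fun i _ => ?_
      ring
    · intro i _
      have := (contDiff_fderiv_apply hu
        (EuclideanSpace.single i 1)).continuous_fderiv one_ne_zero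
      exact ContinuousOn.integrableOn_compact hB (by fun_prop)
  · refine Continuous.continuousOn ?_ |>.integrableOn_compact hB
    have := (ContinuousLinearMap.toSpanSingletonCLE (𝕜 := ℝ) (E := ℝ)).continuous
    exact this.comp (by fun_prop)

variable (N) in
/-- The parameter set `[0, 1] × closedBall 0 1`. -/
abbrev unitCylinder : Set (ℝ × (𝔼 N)) := Set.Icc 0 1 ×ˢ Metric.closedBall 0 1

lemma isCompact_unitCylinder : IsCompact (unitCylinder N) :=
  isCompact_Icc.prod (isCompact_closedBall 0 1)

lemma setIntegral_unitCylinder {h : ℝ × (𝔼 N) → ℝ} (hh : Continuous h) :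
    ∫ p in unitCylinder N, h p =
      ∫ t in (0 : ℝ)..1, ∫ y in Metric.closedBall 0 1, h (t, y) := by
  rw [unitCylinder, Measure.volume_eq_prod, setIntegral_prod,
    intervalIntegral.integral_of_le zero_le_one, integral_Icc_eq_integral_Ioc]
  rw [← Measure.volume_eq_prod]
  exact hh.continuousOn.integrableOn_compact isCompact_unitCylinder

/-- Representation of a `C²` function by its averages and those of its Laplacian. -/
lemma ballAverage_sub_eq {u : (𝔼 N) → ℝ} (hu : ContDiff ℝ 2 u) (x : 𝔼 N) :
    (∫ y in Metric.closedBall 0 1, u (x + y) * ballKernel 2 y) -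
      u x * ∫ y : 𝔼 N, ballKernel 2 y =
    ∫ p in unitCylinder N, lap u (x + p.1 • p.2) * (p.1 / 6 * ballKernel 3 p.2) := by
  have hlap := continuous_lap hu
  have hk3 := continuous_ballKernel (E := 𝔼 N) 3
  rw [setIntegral_unitCylinder (by fun_prop),
    intervalIntegral.integral_eq_sub_of_hasDerivAt (fun t _ => hasDerivAt_ballAverage hu x t)]
  · simp only [one_smul, zero_smul, add_zero, integral_const_mul]
    rw [setIntegral_eq_integral_of_forall_compl_eq_zero (f := ballKernel 2)
      fun y hy => ballKernel_eq_zero 1 hy]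
  · refine Continuous.intervalIntegrable ?_ _ _
    refine continuous_parametric_integral_of_continuous (μ := volume)
      (f := fun (t : ℝ) (y : 𝔼 N) => lap u (x + t • y) * (t / 6 * ballKernel 3 y)) ?_
      (isCompact_closedBall 0 1)
    simp only [Function.uncurry_def]
    fun_prop

/-- The right-hand side of the representation formula for the gradient. -/
noncomputable def gradientPotential (u g : (𝔼 N) → ℝ) (x : 𝔼 N) : (𝔼 N) →L[ℝ] ℝ :=
  -((∫ y : 𝔼 N, ballKernel 2 y)⁻¹ • (
    translateAverage volume (Metric.closedBall 0 1) id (fderiv ℝ (ballKernel 2)) u x +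
    translateAverage volume (unitCylinder N) (fun p => p.1 • p.2)
      (fun p => (1 / 6 : ℝ) • fderiv ℝ (ballKernel 3) p.2) g x))

lemma continuous_fderiv_ballKernel (n : ℕ) :
    Continuous (fderiv ℝ (ballKernel (n + 2) : (𝔼 N) → ℝ)) :=
  (contDiff_ballKernel n).continuous_fderiv one_ne_zero

lemma continuous_scaledShift : Continuous fun p : ℝ × (𝔼 N) => p.1 • p.2 := by
  fun_prop

lemma continuous_gradientWeight :
    Continuous fun p : ℝ × (𝔼 N) => (1 / 6 : ℝ) • fderiv ℝ (ballKernel 3) p.2 := by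
  have := continuous_fderiv_ballKernel (N := N) 1
  fun_prop

/-- Representation of the gradient of a solution of `-Δ u = f(u)`, in which no derivatives of
`u` appear on the right-hand side. -/
lemma fderiv_eq_gradientPotential {u f : _} (hf : ContDiff ℝ 1 f) (hu : ContDiff ℝ 2 u)
    (heq : ∀ x : 𝔼 N, -lap u x = f (u x)) (x : 𝔼 N) :
    fderiv ℝ u x = gradientPotential u (f ∘ u) x := by
  have hu1 : ContDiff ℝ 1 u := hu.of_le (by norm_num)
  have hfu : ContDiff ℝ 1 (f ∘ u) := hf.comp hu1
  have hfuc := hfu.continuous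
  have hfu' := hfu.continuous_fderiv one_ne_zero
  have hk2 := continuous_ballKernel (E := 𝔼 N) 2
  have hk3 := continuous_ballKernel (E := 𝔼 N) 3
  have hdk2 := continuous_fderiv_ballKernel (N := N) 0
  have hdk3 := continuous_fderiv_ballKernel (N := N) 1
  have hB := isCompact_closedBall (0 : 𝔼 N) 1
  have hc := integral_ballKernel_pos (E := 𝔼 N) 1 volume
  have hw : Continuous fun p : ℝ × (𝔼 N) => p.1 / 6 * ballKernel 3 p.2 := by fun_prop
  have hs := continuous_scaledShift (N := N)
  have key : (fun x => u x * ∫ y : 𝔼 N, ballKernel 2 y) = fun x =>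
      translateAverage volume (Metric.closedBall 0 1) id (ballKernel 2) u x +
      translateAverage volume (unitCylinder N) (fun p => p.1 • p.2)
        (fun p => p.1 / 6 * ballKernel 3 p.2) (f ∘ u) x := by
    funext x
    have h := ballAverage_sub_eq hu x
    have h2 : ∀ x, lap u x = -(f ∘ u) x := fun x => by simp [← heq]
    simp only [h2, neg_mul, integral_neg] at h
    simp only [translateAverage, smul_eq_mul, id]
    linarith
  ext e
  have hd1 : HasFDerivAt (fun x => u x * ∫ y : 𝔼 N, ballKernel 2 y) _ x :=
    (hu1.differentiable one_ne_zero x).hasFDerivAt.mul_const _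
  have hd2 := (contDiff_translateAverage (μ := volume) hB continuous_id hk2 hu1).differentiable
    one_ne_zero x
  have hd3 := (contDiff_translateAverage (μ := volume) isCompact_unitCylinder hs hw
    hfu).differentiable one_ne_zero x
  have h := DFunLike.congr_fun hd1.fderiv e
  rw [key, fderiv_fun_add hd2 hd3, add_apply,
    fderiv_translateAverage_apply hB continuous_id hk2 hu1,
    fderiv_translateAverage_apply isCompact_unitCylinder hs hw hfu] at h
  have e1 : translateAverage volume (Metric.closedBall 0 1) id (ballKernel 2)
      (fun z => fderiv ℝ u z e) x =
      -translateAverage volume (Metric.closedBall 0 1) id (fderiv ℝ (ballKernel 2)) u x e := by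
    have := setIntegral_mul_fderiv_kernel (μ := volume) (contDiff_ballKernel 0)
      (fun y hy => ballKernel_eq_zero 1 hy) hu1 x e 1
    simp only [one_smul, one_mul] at this
    rw [translateAverage, translateAverage, ContinuousLinearMap.integral_apply
      (integrableOn_translateAverage hB continuous_id hdk2 hu.continuous x)]
    simp only [id, smul_eq_mul, smul_apply]
    rw [this, neg_neg]
  have e2 : translateAverage volume (unitCylinder N) (fun p => p.1 • p.2)
        (fun p => p.1 / 6 * ballKernel 3 p.2) (fun z => fderiv ℝ (f ∘ u) z e) x =
      -translateAverage volume (unitCylinder N) (fun p => p.1 • p.2)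
        (fun p => (1 / 6 : ℝ) • fderiv ℝ (ballKernel 3) p.2) (f ∘ u) x e := by
    rw [translateAverage, translateAverage, ContinuousLinearMap.integral_apply
      (integrableOn_translateAverage isCompact_unitCylinder hs continuous_gradientWeight hfuc x)]
    simp only [smul_eq_mul, smul_apply]
    rw [setIntegral_unitCylinder (by fun_prop), setIntegral_unitCylinder (by fun_prop),
      ← intervalIntegral.integral_neg]
    refine intervalIntegral.integral_congr fun t _ => ?_
    have := setIntegral_mul_fderiv_kernel (μ := volume) (contDiff_ballKernel 1)
      (fun y hy => ballKernel_eq_zero 2 hy) hfu x e t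
    calc _ = ∫ y in Metric.closedBall 0 1, 1 / 6 *
          (t * fderiv ℝ (f ∘ u) (x + t • y) e * ballKernel 3 y) := by
          congr with y
          ring
      _ = -∫ y in Metric.closedBall 0 1, 1 / 6 *
          ((f ∘ u) (x + t • y) * fderiv ℝ (ballKernel 3) y e) := by
          rw [integral_const_mul, integral_const_mul, this]
          ring
      _ = _ := by
          congr with y
          ring
  rw [e1, e2] at h
  simp only [gradientPotential, neg_apply, smul_apply,
    add_apply, smul_eq_mul] at h ⊢
  field_simp
  linarith

lemma contDiff_gradientPotential {u g : (𝔼 N) → ℝ} (hu : ContDiff ℝ 1 u) (hg : ContDiff ℝ 1 g) :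
    ContDiff ℝ 1 (gradientPotential u g) := by
  have hdk2 := continuous_fderiv_ballKernel (N := N) 0
  exact (((contDiff_translateAverage (μ := volume) (isCompact_closedBall 0 1)
    continuous_id hdk2 hu).add
    (contDiff_translateAverage (μ := volume) isCompact_unitCylinder
    continuous_scaledShift continuous_gradientWeight hg)).const_smul _).neg

lemma continuous_gradientPotential {u g : (𝔼 N) → ℝ} (hu : Continuous u) (hg : Continuous g) :
    Continuous (gradientPotential u g) := by
  have hdk2 := continuous_fderiv_ballKernel (N := N) 0
  exact (((continuous_translateAverage (μ := volume) (isCompact_closedBall 0 1)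
    continuous_id hdk2 hu).add
    (continuous_translateAverage (μ := volume) isCompact_unitCylinder continuous_scaledShift
      continuous_gradientWeight hg)).const_smul (∫ y : 𝔼 N, ballKernel 2 y)⁻¹).neg

lemma fderiv_gradientPotential_apply {u g : (𝔼 N) → ℝ} (hu : ContDiff ℝ 1 u)
    (hg : ContDiff ℝ 1 g) (x e : 𝔼 N) :
    fderiv ℝ (gradientPotential u g) x e =
      gradientPotential (fun z => fderiv ℝ u z e) (fun z => fderiv ℝ g z e) x := by
  have hdk2 := continuous_fderiv_ballKernel (N := N) 0
  have hB := isCompact_closedBall (0 : 𝔼 N) 1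
  have h1 := (contDiff_translateAverage (μ := volume) hB continuous_id hdk2 hu).differentiable
    one_ne_zero x
  have h2 := (contDiff_translateAverage (μ := volume) isCompact_unitCylinder continuous_scaledShift
    continuous_gradientWeight
    hg).differentiable one_ne_zero x
  have h := ((h1.hasFDerivAt.add h2.hasFDerivAt).const_smul
    (∫ y : 𝔼 N, ballKernel 2 y)⁻¹).neg.fderiv
  have h' := DFunLike.congr_fun h e
  simp only [neg_apply, smul_apply, add_apply] at h'
  rw [fderiv_translateAverage_apply hB continuous_id hdk2 hu,
    fderiv_translateAverage_apply isCompact_unitCylinder continuous_scaledShift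
    continuous_gradientWeight hg] at h'
  exact h'

lemma tendstoLocallyUniformly_gradientPotential {u g : ℕ → (𝔼 N) → ℝ} {v h : (𝔼 N) → ℝ}
    (hu : ∀ n, Continuous (u n)) (hv : Continuous v) (hg : ∀ n, Continuous (g n))
    (hh : Continuous h) (huv : TendstoLocallyUniformly u v atTop)
    (hgh : TendstoLocallyUniformly g h atTop) :
    TendstoLocallyUniformly (fun n => gradientPotential (u n) (g n)) (gradientPotential v h)
      atTop := by
  have hdk2 := continuous_fderiv_ballKernel (N := N) 0
  have h1 := tendstoLocallyUniformly_translateAverage (μ := volume)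
    (isCompact_closedBall (0 : 𝔼 N) 1) continuous_id hdk2 hu hv huv
  have h2 := tendstoLocallyUniformly_translateAverage (μ := volume)
    isCompact_unitCylinder continuous_scaledShift continuous_gradientWeight hg hh hgh
  exact (uniformContinuous_neg.comp (uniformContinuous_const_smul
    (∫ y : 𝔼 N, ballKernel 2 y)⁻¹)).comp_tendstoLocallyUniformly (h1.add h2)

lemma tendsto_gradientPotential_of_bounded {u g : ℕ → (𝔼 N) → ℝ} {v h : (𝔼 N) → ℝ} {M : ℝ}
    (hu : ∀ n, Continuous (u n)) (hg : ∀ n, Continuous (g n)) (huM : ∀ n x, |u n x| ≤ M)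
    (hgM : ∀ n x, |g n x| ≤ M) (huv : ∀ x, Tendsto (fun n => u n x) atTop (𝓝 (v x)))
    (hgh : ∀ x, Tendsto (fun n => g n x) atTop (𝓝 (h x))) (x : 𝔼 N) :
    Tendsto (fun n => gradientPotential (u n) (g n) x) atTop
      (𝓝 (gradientPotential v h x)) := by
  have hdk2 := continuous_fderiv_ballKernel (N := N) 0
  exact (((tendsto_translateAverage_of_bounded (isCompact_closedBall 0 1) continuous_id hdk2 hu
    huM huv x).add (tendsto_translateAverage_of_bounded isCompact_unitCylinder continuous_scaledShift
    continuous_gradientWeight hg hgM hgh x)).const_smul _).neg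

lemma exists_norm_gradientPotential_le (M : ℝ) : ∃ L, ∀ (u g : (𝔼 N) → ℝ),
    (∀ x, |u x| ≤ M) → (∀ x, |g x| ≤ M) → ∀ x, ‖gradientPotential u g x‖ ≤ L := by
  have hdk2 := continuous_fderiv_ballKernel (N := N) 0
  obtain ⟨C, -, hC⟩ := exists_norm_translateAverage_le (μ := volume) (s := id)
    (isCompact_closedBall (0 : 𝔼 N) 1) hdk2
  obtain ⟨D, -, hD⟩ := exists_norm_translateAverage_le (μ := volume)
    (s := fun p : ℝ × (𝔼 N) => p.1 • p.2) isCompact_unitCylinder continuous_gradientWeight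
  refine ⟨|(∫ y : 𝔼 N, ballKernel 2 y)⁻¹| * (M * C + M * D), fun u g hu hg x => ?_⟩
  rw [gradientPotential, norm_neg, norm_smul, Real.norm_eq_abs]
  gcongr
  exact (norm_add_le _ _).trans (add_le_add (hC u M x fun _ _ => hu _) (hD g M x fun _ _ => hg _))

lemma exists_abs_comp_le {g : ℝ → ℝ} (hg : Continuous g) (M : ℝ) :
    ∃ C, ∀ s, |s| ≤ M → |g s| ≤ C := by
  obtain ⟨C, hC⟩ := (isCompact_Icc (a := -M) (b := M)).exists_bound_of_continuousOn hg.continuousOn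
  exact ⟨C, fun s hs => hC s (abs_le.1 hs)⟩

/-- Bounded solutions of `-Δ u = f(u)` have bounded gradient. -/
lemma exists_norm_fderiv_le {f : ℝ → ℝ} (hf : ContDiff ℝ 1 f) (M : ℝ) :
    ∃ L, ∀ u : (𝔼 N) → ℝ, ContDiff ℝ 2 u → (∀ x, |u x| ≤ M) → (∀ x, -lap u x = f (u x)) →
      ∀ x, ‖fderiv ℝ u x‖ ≤ L := by
  obtain ⟨C, hC⟩ := exists_abs_comp_le hf.continuous M
  obtain ⟨L, hL⟩ := exists_norm_gradientPotential_le (N := N) (max M C)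
  refine ⟨L, fun u hu hM heq x => ?_⟩
  rw [fderiv_eq_gradientPotential hf hu heq]
  exact hL _ _ (fun x => (hM x).trans (le_max_left _ _))
    (fun x => (hC _ (hM x)).trans (le_max_right _ _)) x

/-- Locally uniform limits of uniformly bounded `C²` solutions of `-Δ u = f(u)` are `C²`
solutions. -/
lemma contDiff_and_solution_of_tendsto {f : ℝ → ℝ} (hf : ContDiff ℝ 1 f) {M : ℝ}
    {u : ℕ → C(𝔼 N, ℝ)} {v : C(𝔼 N, ℝ)} (hu : ∀ n, ContDiff ℝ 2 (u n))
    (hM : ∀ n x, |u n x| ≤ M) (heq : ∀ n x, -lap (u n) x = f (u n x))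
    (huv : Tendsto u atTop (𝓝 v)) :
    ContDiff ℝ 2 v ∧ ∀ x, -lap v x = f (v x) := by
  let F : C(ℝ, ℝ) := ⟨f, hf.continuous⟩
  have hfuv : Tendsto (fun n => F.comp (u n)) atTop (𝓝 (F.comp v)) :=
    (F.continuous_postcomp.tendsto v).comp huv
  have hpt : ∀ x, Tendsto (fun n => u n x) atTop (𝓝 (v x)) := fun x =>
    ((continuous_eval_const x).tendsto v).comp huv
  rw [ContinuousMap.tendsto_iff_tendstoLocallyUniformly] at huv hfuv
  have hu1 : ∀ n, ContDiff ℝ 1 (u n) := fun n => (hu n).of_le (by norm_num)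
  have hlim := tendstoLocallyUniformly_gradientPotential (fun n => (u n).continuous) v.continuous
    (fun n => (F.comp (u n)).continuous) (F.comp v).continuous huv hfuv
  have hdu : ∀ n x, fderiv ℝ (u n) x = gradientPotential (u n) (f ∘ u n) x := fun n x =>
    fderiv_eq_gradientPotential hf (hu n) (heq n) x
  have hdv : ∀ x, HasFDerivAt v (gradientPotential v (f ∘ v) x) x := fun x => by
    refine hasFDerivAt_of_tendstoLocallyUniformlyOn isOpen_univ
      (tendstoLocallyUniformlyOn_univ.2 hlim) (fun n x _ => ?_) (fun x _ => hpt x)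
      (Set.mem_univ x)
    exact (hdu n x) ▸ ((hu1 n).differentiable one_ne_zero x).hasFDerivAt
  have hv1 : ContDiff ℝ 1 v := contDiff_one_iff_hasFDerivAt.2
    ⟨_, continuous_gradientPotential v.continuous (hf.continuous.comp v.continuous), hdv⟩
  have hfv1 : ContDiff ℝ 1 (f ∘ v) := hf.comp hv1
  have hv2 : ContDiff ℝ 2 v := (contDiff_succ_iff_hasFDerivAt (n := 1)).2
    ⟨_, contDiff_gradientPotential hv1 hfv1, hdv⟩
  refine ⟨hv2, fun x => ?_⟩
  have hlap : ∀ w : (𝔼 N) → ℝ, ContDiff ℝ 1 w →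
      (∀ x, fderiv ℝ w x = gradientPotential w (f ∘ w) x) → lap w x =
        ∑ i, gradientPotential (fun z => fderiv ℝ w z (EuclideanSpace.single i 1))
          (fun z => fderiv ℝ (f ∘ w) z (EuclideanSpace.single i 1)) x
          (EuclideanSpace.single i 1) := fun w hw hdw => by
    refine Finset.sum_congr rfl fun i _ => ?_
    have h2 : fderiv ℝ (fderiv ℝ w) x = fderiv ℝ (gradientPotential w (f ∘ w)) x := by
      congr 1
      exact funext hdw
    rw [iteratedFDeriv_two_apply, h2]
    simp [fderiv_gradientPotential_apply hw (hf.comp hw)]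
  obtain ⟨L, hL⟩ := exists_norm_fderiv_le (N := N) hf M
  obtain ⟨C, hC⟩ := exists_abs_comp_le (hf.continuous_deriv le_rfl) M
  have hcomp : ∀ w : (𝔼 N) → ℝ, ContDiff ℝ 1 w → ∀ z e,
      fderiv ℝ (f ∘ w) z e = deriv f (w z) * fderiv ℝ w z e := fun w hw z e => by
    rw [((hf.differentiable one_ne_zero _).hasDerivAt.comp_hasFDerivAt z
      (hw.differentiable one_ne_zero z).hasFDerivAt).fderiv]
    simp
  have hdpt : ∀ x e, Tendsto (fun n => fderiv ℝ (u n) x e) atTop (𝓝 (fderiv ℝ v x e)) := by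
    intro x e
    have h1 := (tendstoLocallyUniformlyOn_univ.2 hlim).tendsto_at (Set.mem_univ x)
    simp_rw [hdu, (hdv x).fderiv]
    exact ((ContinuousLinearMap.apply ℝ ℝ e).continuous.tendsto _).comp h1
  have hbd : ∀ (e : 𝔼 N) n z, |fderiv ℝ (u n) z e| ≤ L * ‖e‖ := fun e n z =>
    ((fderiv ℝ (u n) z).le_opNorm e).trans
      (mul_le_mul_of_nonneg_right (hL _ (hu n) (hM n) (heq n) z) (norm_nonneg e))
  have hlaplim : Tendsto (fun n => lap (u n) x) atTop (𝓝 (lap v x)) := by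
    rw [hlap v hv1 fun x => (hdv x).fderiv]
    simp_rw [fun n => hlap (u n) (hu1 n) (hdu n)]
    refine tendsto_finsetSum _ fun i _ => ?_
    set e : 𝔼 N := EuclideanSpace.single i 1
    refine ((ContinuousLinearMap.apply ℝ ℝ e).continuous.tendsto _).comp
      (tendsto_gradientPotential_of_bounded (M := max (L * ‖e‖) (C * (L * ‖e‖)))
        (fun n => ?_) (fun n => ?_) (fun n z => ?_) (fun n z => ?_) (fun z => hdpt z e)
        (fun z => ?_) x)
    · exact ((hu1 n).continuous_fderiv one_ne_zero).clm_apply continuous_const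
    · exact ((hf.comp (hu1 n)).continuous_fderiv one_ne_zero).clm_apply continuous_const
    · exact (hbd e n z).trans (le_max_left _ _)
    · refine le_trans ?_ (le_max_right _ _)
      rw [hcomp _ (hu1 n), abs_mul]
      exact mul_le_mul (hC _ (hM n z)) (hbd e n z) (abs_nonneg _)
        ((abs_nonneg _).trans (hC _ (hM n z)))
    · simp_rw [hcomp _ (hu1 _), hcomp _ hv1]
      exact (((hf.continuous_deriv le_rfl).tendsto _).comp (hpt z)).mul (hdpt z e)
  refine tendsto_nhds_unique hlaplim.neg ?_
  simp_rw [heq]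
  exact (hf.continuous.tendsto _).comp (hpt x)

end Representation

section Compactness

variable {X : Type*} [MetricSpace X] [ProperSpace X]

lemma isCompact_bounded_lipschitz (M : ℝ) (L : NNReal) :
    IsCompact {g : C(X, ℝ) | (∀ x, |g x| ≤ M) ∧ LipschitzWith L g} := by
  refine ArzelaAscoli.isCompact_of_equicontinuous _ ?_ ?_
  · have himage : Set.image ContinuousMap.toFun
        {g : C(X, ℝ) | (∀ x, |g x| ≤ M) ∧ LipschitzWith L g} =
        (Set.univ.pi fun _ => Set.Icc (-M) M) ∩ {g | LipschitzWith L g} := by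
      ext g
      constructor
      · rintro ⟨g, ⟨hM, hL⟩, rfl⟩
        exact ⟨fun x _ => abs_le.1 (hM x), hL⟩
      · rintro ⟨hM, hL⟩
        exact ⟨⟨g, hL.continuous⟩, ⟨fun x => abs_le.2 (hM x trivial), hL⟩, rfl⟩
    rw [himage]
    refine (isCompact_univ_pi fun _ => isCompact_Icc).inter_right ?_
    simp only [lipschitzWith_iff_dist_le_mul, Set.ofPred_forall]
    exact isClosed_iInter fun x => isClosed_iInter fun y =>
      isClosed_le (by fun_prop) continuous_const
  · exact (LipschitzWith.uniformEquicontinuous _ L fun g => g.2.2).equicontinuous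

end Compactness

section Stability

variable {N : ℕ}

lemma norm_gradient (φ : EuclideanSpace ℝ (Fin N) → ℝ) (x : EuclideanSpace ℝ (Fin N)) :
    ‖gradient φ x‖ = ‖fderiv ℝ φ x‖ := by
  simp [gradient]

lemma lap_comp_add_right (u : EuclideanSpace ℝ (Fin N) → ℝ) (a x : EuclideanSpace ℝ (Fin N)) :
    lap (fun z => u (z + a)) x = lap u (x + a) := by
  simp only [lap, iteratedFDeriv_comp_add_right]

/-- If translates of a function stable outside a compact set escape to infinity, their limits are
stable. -/
lemma stable_of_tendsto_translates {g : ℝ → ℝ} (hg : Continuous g)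
    {u v : EuclideanSpace ℝ (Fin N) → ℝ} (hu : Continuous u) {M : ℝ} (hM : ∀ x, |u x| ≤ M)
    {K : Set (EuclideanSpace ℝ (Fin N))} (hK : IsCompact K) (hst : StableOutside g u K)
    {a : ℕ → EuclideanSpace ℝ (Fin N)} (ha : Tendsto (fun n => ‖a n‖) atTop atTop)
    (huv : ∀ x, Tendsto (fun n => u (x + a n)) atTop (𝓝 (v x))) : Stable g v := by
  intro φ hφ hφc
  obtain ⟨C, hC⟩ := exists_abs_comp_le hg M
  have hlim : Tendsto (fun n => ∫ x, g (u (x + a n)) * φ x ^ 2) atTop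
      (𝓝 (∫ x, g (v x) * φ x ^ 2)) := by
    have hφ' := hφ.continuous
    refine tendsto_integral_of_dominated_convergence (fun x => C * φ x ^ 2) (fun n => ?_) ?_
      (fun n => .of_forall fun x => ?_) (.of_forall fun x => ?_)
    · exact Continuous.aestronglyMeasurable (by fun_prop)
    · refine Continuous.integrable_of_hasCompactSupport (by fun_prop) ?_
      simp_rw [pow_two]
      exact (hφc.mul_left).mul_left
    · rw [norm_mul, Real.norm_eq_abs, Real.norm_of_nonneg (sq_nonneg (φ x))]
      exact mul_le_mul_of_nonneg_right (hC _ (hM _)) (sq_nonneg _)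
    · exact ((hg.tendsto _).comp (huv x)).mul_const _
  refine le_of_tendsto hlim ?_
  obtain ⟨R, hR⟩ := hK.isBounded.exists_norm_le
  obtain ⟨R', hR'⟩ := hφc.isBounded.exists_norm_le
  filter_upwards [ha.eventually_gt_atTop (R + R')] with n hn
  have hsub : tsupport (fun y => φ (y - a n)) = (fun y => y - a n) ⁻¹' tsupport φ :=
    tsupport_comp_eq_preimage φ (Homeomorph.subRight (a n))
  have h := hst (fun y => φ (y - a n)) (hφ.comp (contDiff_id.sub contDiff_const))
    (hφc.comp_homeomorph (Homeomorph.subRight (a n))) ?_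
  · rw [← integral_add_right_eq_self _ (a n),
      ← integral_add_right_eq_self (fun x => ‖gradient (fun y => φ (y - a n)) x‖ ^ 2) (a n)] at h
    simpa only [norm_gradient, fderiv_comp_sub, add_sub_cancel_right] using h
  · rw [hsub]
    intro y hy hyK
    have h1 := hR y hyK
    have h2 := hR' _ hy
    have h3 : ‖a n‖ ≤ ‖y‖ + ‖y - a n‖ := by
      simpa using norm_sub_le y (y - a n)
    linarith

/-- Constant functions are unstable where the linearized weight is positive. -/
lemma not_stable_const {g : ℝ → ℝ} {s : ℝ} (hs : 0 < g s) :
    ¬ Stable g (fun _ : EuclideanSpace ℝ (Fin N) => s) := by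
  intro hst
  set κ : EuclideanSpace ℝ (Fin N) → ℝ := ballKernel 2
  have hκ : ContDiff ℝ 1 κ := contDiff_ballKernel 0
  have hA : 0 < ∫ x, κ x ^ 2 := by
    have h4 : ∀ x, κ x ^ 2 = ballKernel 4 x := fun x => by
      simp only [κ, ballKernel, ← pow_mul]
    simp_rw [h4]
    exact integral_ballKernel_pos 3 volume
  set A := ∫ x, κ x ^ 2
  set B := ∫ x, ‖fderiv ℝ κ x‖ ^ 2
  have key : ∀ R : ℝ, 0 < R → g s * A ≤ R⁻¹ ^ 2 * B := by
    intro R hR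
    have h := hst (fun x => κ (R⁻¹ • x)) (hκ.comp (contDiff_const_smul R⁻¹))
      ((hasCompactSupport_ballKernel 1).comp_smul (inv_ne_zero hR.ne'))
    simp only [norm_gradient, fderiv_comp_smul, norm_smul, mul_pow] at h
    rw [integral_const_mul, integral_const_mul,
      Measure.integral_comp_inv_smul volume (fun x => κ x ^ 2),
      Measure.integral_comp_inv_smul volume (fun x => ‖fderiv ℝ κ x‖ ^ 2)] at h
    have hpos : 0 < |R ^ Module.finrank ℝ (EuclideanSpace ℝ (Fin N))| := by positivity
    simp only [smul_eq_mul, Real.norm_eq_abs, sq_abs] at h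
    nlinarith
  have hlim : Tendsto (fun R : ℝ => R⁻¹ ^ 2 * B) atTop (𝓝 0) := by
    simpa using (tendsto_inv_atTop_zero.pow 2).mul_const B
  have := ge_of_tendsto hlim ((eventually_gt_atTop 0).mono key)
  have : 0 < g s * A := mul_pos hs hA
  linarith

end Stability

/-- Remark 1.14: if `f'(0) > 0` and `u = 0` is the only bounded stable `C²` solution of
`−Δu = f(u)` in `ℝ^N`, then there is no bounded `C²` solution which is stable outside
a compact set. -/
theorem stmt8 {N : ℕ} (hN : 1 ≤ N) (f : ℝ → ℝ) (hf : ContDiff ℝ 1 f)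
    (hf'0 : 0 < deriv f 0)
    (huniq : ∀ v : EuclideanSpace ℝ (Fin N) → ℝ, ContDiff ℝ 2 v →
      (∃ M, ∀ x, |v x| ≤ M) → (∀ x, -lap v x = f (v x)) → Stable (deriv f) v →
      ∀ x, v x = 0) :
    ¬ ∃ u : EuclideanSpace ℝ (Fin N) → ℝ, ContDiff ℝ 2 u ∧
      (∃ M, ∀ x, |u x| ≤ M) ∧ (∀ x, -lap u x = f (u x)) ∧
      ∃ K : Set (EuclideanSpace ℝ (Fin N)), IsCompact K ∧
        StableOutside (deriv f) u K := by
  rintro ⟨u, hu, ⟨M, hM⟩, heq, K, hK, hst⟩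
  obtain ⟨L, hL⟩ := exists_norm_fderiv_le (N := N) hf M
  have hLip : LipschitzWith L.toNNReal u :=
    lipschitzWith_of_nnnorm_fderiv_le (𝕜 := ℝ) (hu.differentiable two_ne_zero) fun x => by
      rw [← NNReal.coe_le_coe]
      exact (hL u hu hM heq x).trans (Real.le_coe_toNNReal L)
  let a : ℕ → EuclideanSpace ℝ (Fin N) := fun n => EuclideanSpace.single ⟨0, hN⟩ (n : ℝ)
  have ha : Tendsto (fun n => ‖a n‖) atTop atTop := by
    simpa [a] using tendsto_natCast_atTop_atTop (R := ℝ)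
  let w : ℕ → C(EuclideanSpace ℝ (Fin N), ℝ) := fun n =>
    ⟨fun x => u (x + a n), hu.continuous.comp (continuous_id.add continuous_const)⟩
  have hwLip : ∀ n, LipschitzWith L.toNNReal (w n) := fun n =>
    LipschitzWith.of_dist_le_mul fun x y => by
      simpa [w] using hLip.dist_le_mul (x + a n) (y + a n)
  have hw2 : ∀ n, ContDiff ℝ 2 (w n) := fun n => hu.comp (contDiff_id.add contDiff_const)
  have hweq : ∀ n x, -lap (w n) x = f (w n x) := fun n x => by
    rw [show lap (w n) x = lap u (x + a n) from lap_comp_add_right u (a n) x]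
    exact heq _
  obtain ⟨v, ⟨hvM, -⟩, σ, hσ, hlim⟩ := (isCompact_bounded_lipschitz M L.toNNReal).tendsto_subseq
    (x := w) fun n => ⟨fun x => hM _, hwLip n⟩
  obtain ⟨hv2, hveq⟩ := contDiff_and_solution_of_tendsto hf (u := fun n => w (σ n))
    (fun n => hw2 _) (fun n x => hM (x + a (σ n))) (fun n x => hweq _ x) hlim
  have hvst : Stable (deriv f) v :=
    stable_of_tendsto_translates (hf.continuous_deriv le_rfl) hu.continuous hM hK hst
      (ha.comp hσ.tendsto_atTop)
      fun x => ((continuous_eval_const x).tendsto v).comp hlim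
  have hv0 := huniq v hv2 ⟨M, hvM⟩ hveq hvst
  rw [show (v : EuclideanSpace ℝ (Fin N) → ℝ) = fun _ => 0 from funext hv0] at hvst
  exact not_stable_const hf'0 hvst
end

section
/- Let f ∈ C⁰([0,∞)) ∩ C²((0,∞)) be nondecreasing and convex with f > 0 on (0,∞) and f(0) = 0, assume q₀ = lim_{u→0⁺} q(u) exists with conjugate exponent p₀, and assume there are ε, c₁, c₂ > 0 with f(u) ≥ c₁ u^{p₀} and f'(u) ≤ c₂ u^{p₀−1} for u ∈ (0, ε). Assume p₀ is in the supercritical range: p_S(N) < p₀ < +∞ if 3 ≤ N ≤ 10, or p_S(N) < p₀ < p_c(N) if N ≥ 11. Then any bounded positive solution u ∈ C²(ℝ^N) of −Δu = f(u) in ℝ^N which is stable outside a compact set satisfies u(x) = o(|x|^{−2/(p₀−1)}) and |∇u(x)| = o(|x|^{−2/(p₀−1)−1}) as |x| → ∞. -/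
open MeasureTheory Filter Topology
open scoped ENNReal

/-- The necessary second-order condition at a local minimum. -/
lemma IsLocalMin.second_deriv_nonneg {h h' : ℝ → ℝ} {a c : ℝ}
    (hh : ∀ t, HasDerivAt h (h' t) t) (hc : HasDerivAt h' c a) (hm : IsLocalMin h a) :
    0 ≤ c := by
  by_contra! hneg
  have hd : deriv h = h' := funext fun t => (hh t).deriv
  have h0 : deriv h a = 0 := hm.deriv_eq_zero
  have h2 : deriv (deriv h) a < 0 := by rw [hd, hc.deriv]; exact hneg
  have hM := isLocalMax_of_deriv_deriv_neg h2 h0 (hh a).continuousAt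
  have heq : h =ᶠ[𝓝 a] fun _ => h a := by
    filter_upwards [hm, hM] with t h1 h3 using le_antisymm h3 h1
  have h3 : deriv h =ᶠ[𝓝 a] fun _ => (0 : ℝ) := by
    filter_upwards [heq.eventuallyEq_nhds] with t ht
    rw [ht.deriv_eq]; simp
  rw [h3.deriv_eq] at h2
  simp at h2

section Line

variable {E : Type*} [NormedAddCommGroup E] [NormedSpace ℝ E]

lemma hasDerivAt_line {u : E → ℝ} (hu : ContDiff ℝ 2 u) (y v : E) (t : ℝ) :
    HasDerivAt (fun t : ℝ => u (y + t • v)) (fderiv ℝ u (y + t • v) v) t := by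
  have h1 : HasFDerivAt u (fderiv ℝ u (y + t • v)) (y + t • v) :=
    (hu.differentiable (by norm_num) _).hasFDerivAt
  have h2 : HasDerivAt (fun t : ℝ => y + t • v) v t := by
    simpa using ((hasDerivAt_id t).smul_const v).const_add y
  exact h1.comp_hasDerivAt t h2

lemma hasDerivAt_line_fderiv {u : E → ℝ} (hu : ContDiff ℝ 2 u) (y v : E) (t : ℝ) :
    HasDerivAt (fun t : ℝ => fderiv ℝ u (y + t • v) v)
      (iteratedFDeriv ℝ 2 u (y + t • v) ![v, v]) t := by
  have hf : Differentiable ℝ (fderiv ℝ u) :=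
    (hu.fderiv_right (m := 1) (by norm_num)).differentiable (by norm_num)
  have h1 : HasFDerivAt (fderiv ℝ u) (fderiv ℝ (fderiv ℝ u) (y + t • v)) (y + t • v) :=
    (hf _).hasFDerivAt
  have h2 : HasDerivAt (fun t : ℝ => y + t • v) v t := by
    simpa using ((hasDerivAt_id t).smul_const v).const_add y
  have h3 := (ContinuousLinearMap.apply ℝ ℝ v).hasFDerivAt.comp_hasDerivAt t
    (h1.comp_hasDerivAt t h2)
  rw [iteratedFDeriv_two_apply]
  exact h3

end Line

lemma lap_neg {N : ℕ} (u : EuclideanSpace ℝ (Fin N) → ℝ) (x : EuclideanSpace ℝ (Fin N)) :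
    lap (fun y => -u y) x = -lap u x := by
  have : (fun y => -u y) = -u := rfl
  simp [lap, this, iteratedFDeriv_neg_apply]

/-- The reflection through the hyperplane `y i = x i`. -/
noncomputable def reflectCoord {N : ℕ} (i : Fin N) (x y : EuclideanSpace ℝ (Fin N)) :
    EuclideanSpace ℝ (Fin N) :=
  y - (2 * (y i - x i)) • EuclideanSpace.single i (1 : ℝ)

lemma reflectCoord_add_smul_single {N : ℕ} (i j : Fin N) (x y : EuclideanSpace ℝ (Fin N)) (t : ℝ) :
    reflectCoord i x (y + t • EuclideanSpace.single j (1 : ℝ)) = reflectCoord i x y +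
      t • ((if j = i then (-1 : ℝ) else 1) • EuclideanSpace.single j (1 : ℝ)) := by
  ext k
  by_cases hj : j = i
  · subst hj
    by_cases hk : k = j
    · subst hk; simp [reflectCoord]; ring
    · simp [reflectCoord, hk]
  · have hj' : i ≠ j := fun h => hj h.symm
    by_cases hk : k = j
    · subst hk; simp [reflectCoord, hj, hj']
    · simp [reflectCoord, hk, hj, hj']

lemma norm_add_smul_single_sq {N : ℕ} (j : Fin N) (z : EuclideanSpace ℝ (Fin N)) (t : ℝ) :
    ‖z + t • EuclideanSpace.single j (1 : ℝ)‖ ^ 2 = ‖z‖ ^ 2 + 2 * t * z j + t ^ 2 := by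
  rw [norm_add_sq_real, inner_smul_right, norm_smul, EuclideanSpace.inner_single_right]
  simp
  ring

lemma norm_reflectCoord_sub {N : ℕ} (i : Fin N) (x y : EuclideanSpace ℝ (Fin N)) :
    ‖reflectCoord i x y - x‖ = ‖y - x‖ := by
  have h : reflectCoord i x y - x =
      (y - x) + (-(2 * (y i - x i))) • EuclideanSpace.single i (1 : ℝ) := by
    simp only [reflectCoord, neg_smul]; abel
  have h2 : ‖reflectCoord i x y - x‖ ^ 2 = ‖y - x‖ ^ 2 := by
    rw [h, norm_add_smul_single_sq]; simp; ring
  exact (pow_left_inj₀ (norm_nonneg _) (norm_nonneg _) (by norm_num)).1 h2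

/-- Comparison of the odd part of `u` with an explicit barrier on a half ball. -/
lemma sub_reflectCoord_le {N : ℕ} {u : EuclideanSpace ℝ (Fin N) → ℝ} (hu : ContDiff ℝ 2 u)
    {x : EuclideanSpace ℝ (Fin N)} {d m F : ℝ} (hd : 0 < d)
    (hm : ∀ y ∈ Metric.closedBall x d, |u y| ≤ m)
    (hF : ∀ y ∈ Metric.closedBall x d, |lap u y| < F) (i : Fin N)
    {y : EuclideanSpace ℝ (Fin N)} (hy : y ∈ Metric.closedBall x d) (hyi : 0 ≤ y i - x i) :
    u y - u (reflectCoord i x y) ≤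
      2 * m / d ^ 2 * (‖y - x‖ ^ 2 + N * ((y i - x i) * (d - (y i - x i)))) +
        F * ((y i - x i) * (d - (y i - x i))) := by
  have hm0 : 0 ≤ m := (abs_nonneg _).trans (hm x (by simp [hd.le]))
  have hF0 : 0 < F := (abs_nonneg _).trans_lt (hF x (by simp [hd.le]))
  set A : ℝ := 2 * m / d ^ 2 with hA
  have hA0 : 0 ≤ A := by positivity
  let S : Set (EuclideanSpace ℝ (Fin N)) := Metric.closedBall x d ∩ {y | 0 ≤ y i - x i}
  have hS : IsCompact S := by
    refine (isCompact_closedBall x d).inter_right ?_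
    exact isClosed_le continuous_const (by fun_prop)
  let h : EuclideanSpace ℝ (Fin N) → ℝ := fun y =>
    A * (‖y - x‖ ^ 2 + N * ((y i - x i) * (d - (y i - x i)))) +
        F * ((y i - x i) * (d - (y i - x i))) - u y + u (reflectCoord i x y)
  have hcu := hu.continuous
  have hcont : Continuous h := by
    have : Continuous (reflectCoord i x) := by unfold reflectCoord; fun_prop
    fun_prop
  obtain ⟨z, hzS, hz⟩ := hS.exists_isMinOn ⟨y, hy, hyi⟩ hcont.continuousOn
  suffices 0 ≤ h z by
    have h1 : h z ≤ h y := hz (show y ∈ S from ⟨hy, hyi⟩)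
    have h2 : 0 ≤ h y := this.trans h1
    simp only [h] at h2
    linarith
  obtain ⟨hzb, hzi⟩ := hzS
  have hzi : 0 ≤ z i - x i := hzi
  have hcoord : z i - x i ≤ ‖z - x‖ := by
    have := PiLp.norm_apply_le (z - x) i
    simp only [PiLp.sub_apply, Real.norm_eq_abs] at this
    exact (le_abs_self _).trans this
  have hzn : ‖z - x‖ ≤ d := by simpa [dist_eq_norm] using hzb
  have hzr : reflectCoord i x z ∈ Metric.closedBall x d := by
    rw [Metric.mem_closedBall, dist_eq_norm, norm_reflectCoord_sub]; exact hzn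
  have hq : 0 ≤ (z i - x i) * (d - (z i - x i)) := mul_nonneg hzi (by linarith)
  rcases hzi.eq_or_lt with h0 | hpos
  · have hr : reflectCoord i x z = z := by simp [reflectCoord, ← h0]
    simp only [h, hr]
    have : 0 ≤ A * (‖z - x‖ ^ 2 + N * ((z i - x i) * (d - (z i - x i)))) := by positivity
    have : 0 ≤ F * ((z i - x i) * (d - (z i - x i))) := by positivity
    linarith
  rcases hzn.eq_or_lt with h0 | hlt
  · have h1 := (abs_le.1 (hm z hzb)).2
    have h2 := (abs_le.1 (hm _ hzr)).1
    have h3 : A * ‖z - x‖ ^ 2 = 2 * m := by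
      rw [h0, hA]; field_simp
    have h4 : 0 ≤ A * (N * ((z i - x i) * (d - (z i - x i)))) := by positivity
    have h5 : 0 ≤ F * ((z i - x i) * (d - (z i - x i))) := by positivity
    simp only [h]
    linarith
  · exfalso
    have hloc : IsLocalMin h z := by
      have hopen : IsOpen (Metric.ball x d ∩ {y | 0 < y i - x i}) :=
        Metric.isOpen_ball.inter (isOpen_lt continuous_const (by fun_prop))
      have hmem : z ∈ Metric.ball x d ∩ {y | 0 < y i - x i} :=
        ⟨by simpa [dist_eq_norm] using hlt, hpos⟩
      filter_upwards [hopen.mem_nhds hmem] with y hy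
      exact hz (show y ∈ S from ⟨Metric.ball_subset_closedBall hy.1,
        le_of_lt (show 0 < y i - x i from hy.2)⟩)
    have key : ∀ j : Fin N, 0 ≤ 2 * A - (if j = i then 2 * A * N + 2 * F else 0)
        - iteratedFDeriv ℝ 2 u z ![EuclideanSpace.single j 1, EuclideanSpace.single j 1]
        + iteratedFDeriv ℝ 2 u (reflectCoord i x z)
            ![EuclideanSpace.single j 1, EuclideanSpace.single j 1] := by
      intro j
      set e : EuclideanSpace ℝ (Fin N) := EuclideanSpace.single j 1 with he
      set δ : ℝ := if j = i then 1 else 0 with hδ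
      set s : ℝ := if j = i then (-1 : ℝ) else 1 with hs
      set b : ℝ := z i - x i with hb
      have hfun : ∀ t : ℝ, h (z + t • e) =
          A * (‖z - x‖ ^ 2 + 2 * t * (z j - x j) + t ^ 2
            + N * ((b + t * δ) * (d - (b + t * δ))))
          + F * ((b + t * δ) * (d - (b + t * δ))) - u (z + t • e)
          + u (reflectCoord i x z + t • (s • e)) := by
        intro t
        have h1 : z + t • e - x = (z - x) + t • e := by abel
        have h2 : (z + t • e) i - x i = b + t * δ := by
          simp only [he, hδ, hb]
          by_cases hj : j = i
          · subst hj; simp; ring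
          · simp [hj]
        simp only [h, h2]
        rw [he, reflectCoord_add_smul_single, ← he, h1, he, norm_add_smul_single_sq, ← he]
        rfl
      have hd1 : ∀ t : ℝ, HasDerivAt (fun t : ℝ => h (z + t • e))
          (A * (2 * (z j - x j) + 2 * t + N * (δ * (d - 2 * (b + t * δ))))
            + F * (δ * (d - 2 * (b + t * δ))) - fderiv ℝ u (z + t • e) e
            + fderiv ℝ u (reflectCoord i x z + t • (s • e)) (s • e)) t := by
        intro t
        rw [funext hfun]
        have hid := hasDerivAt_id' t
        have hl : HasDerivAt (fun t : ℝ => b + t * δ) δ t := by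
          simpa using (hid.mul_const δ).const_add b
        have hp : HasDerivAt (fun t : ℝ => (b + t * δ) * (d - (b + t * δ)))
            (δ * (d - 2 * (b + t * δ))) t := by
          refine (hl.mul (hl.const_sub d)).congr_deriv ?_
          ring
        have hq : HasDerivAt (fun t : ℝ => ‖z - x‖ ^ 2 + 2 * t * (z j - x j) + t ^ 2)
            (2 * (z j - x j) + 2 * t) t := by
          refine ((((hid.const_mul 2).mul_const (z j - x j)).const_add (‖z - x‖ ^ 2)).add
            (hid.pow 2)).congr_deriv ?_
          simp
        exact ((((hq.add (hp.const_mul (N : ℝ))).const_mul A).add (hp.const_mul F)).sub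
          (hasDerivAt_line hu z e t)).add (hasDerivAt_line hu (reflectCoord i x z) (s • e) t)
      have hd2 : HasDerivAt (fun t : ℝ =>
          (A * (2 * (z j - x j) + 2 * t + N * (δ * (d - 2 * (b + t * δ))))
            + F * (δ * (d - 2 * (b + t * δ))) - fderiv ℝ u (z + t • e) e
            + fderiv ℝ u (reflectCoord i x z + t • (s • e)) (s • e)))
          (A * (2 + N * (-(2 * δ ^ 2))) + F * (-(2 * δ ^ 2))
            - iteratedFDeriv ℝ 2 u (z + (0 : ℝ) • e) ![e, e]
            + iteratedFDeriv ℝ 2 u (reflectCoord i x z + (0 : ℝ) • (s • e)) ![s • e, s • e])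
          0 := by
        have hid := hasDerivAt_id' (0 : ℝ)
        have hl : HasDerivAt (fun t : ℝ => δ * (d - 2 * (b + t * δ))) (-(2 * δ ^ 2)) 0 := by
          refine (((((hid.mul_const δ).const_add b).const_mul 2).const_sub d).const_mul
            δ).congr_deriv ?_
          ring
        have hq : HasDerivAt (fun t : ℝ => 2 * (z j - x j) + 2 * t) 2 0 := by
          simpa using (hid.const_mul 2).const_add (2 * (z j - x j))
        exact ((((hq.add (hl.const_mul (N : ℝ))).const_mul A).add (hl.const_mul F)).sub
          (hasDerivAt_line_fderiv hu z e 0)).add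
            (hasDerivAt_line_fderiv hu (reflectCoord i x z) (s • e) 0)
      have hmin : IsLocalMin (fun t : ℝ => h (z + t • e)) 0 := by
        have hc : ContinuousAt (fun t : ℝ => z + t • e) 0 := by fun_prop
        have h0 : z + (0 : ℝ) • e = z := by simp
        have : Tendsto (fun t : ℝ => z + t • e) (𝓝 0) (𝓝 z) := by
          simpa [ContinuousAt] using hc
        have h3 := this.eventually hloc
        simpa [IsLocalMin, IsMinFilter] using h3
      have hres := IsLocalMin.second_deriv_nonneg hd1 hd2 hmin
      have hss : iteratedFDeriv ℝ 2 u (reflectCoord i x z) ![s • e, s • e] =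
          iteratedFDeriv ℝ 2 u (reflectCoord i x z) ![e, e] := by
        simp only [iteratedFDeriv_two_apply]
        simp [hs]
        split_ifs <;> simp
      simp only [zero_smul, add_zero, hss] at hres
      convert hres using 3
      simp only [hδ]
      split_ifs <;> ring
    have hsum := Finset.sum_nonneg fun j (_ : j ∈ Finset.univ) => key j
    simp only [Finset.sum_add_distrib, Finset.sum_sub_distrib, Finset.sum_ite_eq',
      Finset.mem_univ, if_true, Finset.sum_const, Finset.card_univ, Fintype.card_fin,
      nsmul_eq_mul] at hsum
    have h1 := (abs_lt.1 (hF z hzb)).1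
    have h2 := (abs_lt.1 (hF _ hzr)).2
    simp only [lap] at h1 h2
    linarith

lemma fderiv_single_le {N : ℕ} {u : EuclideanSpace ℝ (Fin N) → ℝ} (hu : ContDiff ℝ 2 u)
    {x : EuclideanSpace ℝ (Fin N)} {d m F : ℝ} (hd : 0 < d)
    (hm : ∀ y ∈ Metric.closedBall x d, |u y| ≤ m)
    (hF : ∀ y ∈ Metric.closedBall x d, |lap u y| < F) (i : Fin N) :
    fderiv ℝ u x (EuclideanSpace.single i 1) ≤ N * m / d + F * d / 2 := by
  set e : EuclideanSpace ℝ (Fin N) := EuclideanSpace.single i 1 with he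
  have h1 := hasDerivAt_line hu x e 0
  have h2 := hasDerivAt_line hu x (-e) 0
  simp only [zero_smul, add_zero, map_neg] at h1 h2
  have h3 := (h1.sub h2).tendsto_slope_zero_right
  have h4 : Tendsto (fun t : ℝ => 2 * m / d ^ 2 * (t + N * (d - t)) + F * (d - t))
      (𝓝[>] 0) (𝓝 (2 * m / d ^ 2 * (0 + N * (d - 0)) + F * (d - 0))) := by
    refine Tendsto.mono_left (Continuous.tendsto ?_ 0) nhdsWithin_le_nhds
    fun_prop
  have h5 := le_of_tendsto_of_tendsto h3 h4 ?_
  · have h6 : 2 * m / d ^ 2 * (0 + N * (d - 0)) + F * (d - 0) = 2 * (N * m / d + F * d / 2) := by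
      field_simp
      ring
    linarith
  · filter_upwards [Ioo_mem_nhdsGT hd] with t ht
    have hb : x + t • e ∈ Metric.closedBall x d := by
      simp [dist_eq_norm, norm_smul, he, abs_of_pos ht.1, ht.2.le]
    have hi : (x + t • e) i - x i = t := by simp [he]
    have hr : reflectCoord i x (x + t • e) = x + t • (-e) := by
      rw [he, reflectCoord_add_smul_single]
      simp [reflectCoord]
    have hn : ‖x + t • e - x‖ = t := by
      simp [norm_smul, he, abs_of_pos ht.1]
    have h6 := sub_reflectCoord_le hu hd hm hF i hb (by rw [hi]; exact ht.1.le)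
    rw [hi, hr, hn] at h6
    simp only [zero_add, Pi.sub_apply, zero_smul, add_zero, smul_eq_mul, sub_self, sub_zero]
    rw [inv_mul_le_iff₀ ht.1]
    calc _ ≤ _ := h6
      _ = _ := by ring

/-- Interior gradient estimate. -/
lemma norm_fderiv_le {N : ℕ} {u : EuclideanSpace ℝ (Fin N) → ℝ} (hu : ContDiff ℝ 2 u)
    {x : EuclideanSpace ℝ (Fin N)} {d m F : ℝ} (hd : 0 < d)
    (hm : ∀ y ∈ Metric.closedBall x d, |u y| ≤ m)
    (hF : ∀ y ∈ Metric.closedBall x d, |lap u y| < F) :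
    ‖fderiv ℝ u x‖ ≤ N * (N * m / d + F * d / 2) := by
  set B := N * m / d + F * d / 2 with hB
  have hm0 : 0 ≤ m := (abs_nonneg _).trans (hm x (by simp [hd.le]))
  have hF0 : 0 < F := (abs_nonneg _).trans_lt (hF x (by simp [hd.le]))
  have hB0 : 0 ≤ B := by positivity
  have hle : ∀ i, |fderiv ℝ u x (EuclideanSpace.single i 1)| ≤ B := by
    intro i
    refine abs_le'.2 ⟨fderiv_single_le hu hd hm hF i, ?_⟩
    have := fderiv_single_le (u := fun y => -u y) hu.neg hd (by simpa using hm)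
      (by simpa [lap_neg] using hF) i
    simpa [fderiv_fun_neg] using this
  refine ContinuousLinearMap.opNorm_le_bound _ (by positivity) fun v => ?_
  have hv : v = ∑ i, v i • EuclideanSpace.single i (1 : ℝ) := by
    ext k
    simp [Finset.sum_apply, Pi.single_apply]
  calc ‖fderiv ℝ u x v‖ = ‖∑ i, v i * fderiv ℝ u x (EuclideanSpace.single i 1)‖ := by
        conv_lhs => rw [hv]
        simp
    _ ≤ ∑ i : Fin N, ‖v‖ * B := by
        refine norm_sum_le_of_le _ fun i _ => ?_
        rw [norm_mul]
        exact mul_le_mul (PiLp.norm_apply_le v i) (hle i) (norm_nonneg _) (norm_nonneg _)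
    _ = N * B * ‖v‖ := by simp; ring

lemma sobolev_exponent_consequences {N : ℕ} {p : ℝ} (hN : 3 ≤ N)
    (h : ((N : ℝ) + 2) / ((N : ℝ) - 2) < p) :
    1 < p ∧ 1 < ((N : ℝ) - 2) * (p - 1) / 4 := by
  have hN' : (3 : ℝ) ≤ N := by exact_mod_cast hN
  rw [div_lt_iff₀ (by linarith)] at h
  constructor <;> nlinarith

/-- The algebraic meaning of the supercritical range. -/
lemma sq_sub_one_lt_of_supercritical {N : ℕ} {p : ℝ}
    (hsup : (3 ≤ N ∧ N ≤ 10 ∧ ((N : ℝ) + 2) / ((N : ℝ) - 2) < p) ∨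
      (11 ≤ N ∧ ((N : ℝ) + 2) / ((N : ℝ) - 2) < p ∧ p < pc N)) :
    (((N : ℝ) - 2) * (p - 1) / 4 / p - 1) ^ 2 < (p - 1) / p := by
  have hN : 3 ≤ N := by omega
  have hS : ((N : ℝ) + 2) / ((N : ℝ) - 2) < p := by tauto
  obtain ⟨hp, ha⟩ := sobolev_exponent_consequences hN hS
  have hN' : (3 : ℝ) ≤ N := by exact_mod_cast hN
  set y : ℝ := ((N : ℝ) - 2) * (p - 1) with hy
  have hy4 : 4 < y := by linarith
  have key : ((N : ℝ) - 10) * y ^ 2 - 8 * ((N : ℝ) - 4) * y + 16 * ((N : ℝ) - 2) < 0 := by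
    rcases hsup with ⟨-, h10, -⟩ | ⟨h11, -, hpc⟩
    · have h10' : (N : ℝ) ≤ 10 := by exact_mod_cast h10
      nlinarith [mul_pos (sub_pos.2 hy4) (sub_pos.2 hy4)]
    · have h11' : (11 : ℝ) ≤ N := by exact_mod_cast h11
      set s := Real.sqrt ((N : ℝ) - 1) with hs
      have hs2 : s ^ 2 = (N : ℝ) - 1 := Real.sq_sqrt (by linarith)
      have hs0 : 0 ≤ s := Real.sqrt_nonneg _
      have hs3 : 3 ≤ s := by
        rw [hs]; exact Real.le_sqrt_of_sq_le (by linarith)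
      have hden : 0 < ((N : ℝ) - 2) * ((N : ℝ) - 10) := by nlinarith
      have h1 : p * (((N : ℝ) - 2) * ((N : ℝ) - 10)) < ((N : ℝ) - 2) ^ 2 - 4 * N + 8 * s := by
        rwa [pc, lt_div_iff₀ hden] at hpc
      have hup : ((N : ℝ) - 10) * y - 4 * ((N : ℝ) - 4) < 8 * s := by
        rw [hy]; nlinarith
      have hlo : -(8 * s) < ((N : ℝ) - 10) * y - 4 * ((N : ℝ) - 4) := by nlinarith
      have hsq : (((N : ℝ) - 10) * y - 4 * ((N : ℝ) - 4)) ^ 2 < (8 * s) ^ 2 :=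
        sq_lt_sq' hlo hup
      have h10 : 0 < (N : ℝ) - 10 := by linarith
      by_contra! hcon
      have := mul_nonneg h10.le hcon
      nlinarith
  have hp0 : 0 < p := by linarith
  have hmul : (y - 4 * p) ^ 2 < 16 * p * (p - 1) := by
    have hN2 : 0 < (N : ℝ) - 2 := by linarith
    have hid : ((N : ℝ) - 2) * ((y - 4 * p) ^ 2 - 16 * p * (p - 1)) =
        (p - 1) * ((N : ℝ) - 2) ^ 2 * 0 +
        (((N : ℝ) - 10) * y ^ 2 - 8 * ((N : ℝ) - 4) * y + 16 * ((N : ℝ) - 2)) := by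
      rw [hy]; ring
    by_contra! hcon
    nlinarith [mul_nonneg hN2.le (sub_nonneg.2 hcon)]
  have h1 : (y / 4 / p - 1) ^ 2 = (y - 4 * p) ^ 2 / (16 * p ^ 2) := by
    field_simp
    ring
  have h2 : (p - 1) / p = 16 * p * (p - 1) / (16 * p ^ 2) := by
    field_simp
  rw [h1, h2]
  exact div_lt_div_of_pos_right hmul (by positivity)

/-- The limit of `qfun` bounds `f f''` from below by a multiple of `f' ^ 2` near `0`. -/
lemma eventually_le_of_tendsto_qfun {f : ℝ → ℝ} {q₀ : ℝ≥0∞} {p κ : ℝ}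
    (hq : Tendsto (qfun f) (𝓝[>] (0 : ℝ)) (𝓝 q₀)) (hp : 1 < p)
    (hpq : 1 / ENNReal.ofReal p + 1 / q₀ = 1) (hκ0 : 0 ≤ κ) (hκ : κ < (p - 1) / p)
    (hpos : ∀ t, 0 < t → 0 < f t) (hf2 : ∀ t, 0 < t → 0 ≤ deriv (deriv f) t) :
    ∀ᶠ t in 𝓝[>] (0 : ℝ), κ * deriv f t ^ 2 ≤ f t * deriv (deriv f) t := by
  have hp0 : 0 < p := by linarith
  have hq0 : q₀⁻¹ = ENNReal.ofReal ((p - 1) / p) := by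
    have h1 : 1 / ENNReal.ofReal p = ENNReal.ofReal (1 / p) := by
      rw [ENNReal.ofReal_div_of_pos hp0, ENNReal.ofReal_one]
    have h2 : ENNReal.ofReal (1 / p) + ENNReal.ofReal ((p - 1) / p) = 1 := by
      rw [← ENNReal.ofReal_add (by positivity) (div_nonneg (by linarith) hp0.le),
        ← ENNReal.ofReal_one]
      congr 1
      field_simp
      ring
    rw [h1, one_div q₀] at hpq
    replace hpq := hpq.trans h2.symm
    exact (ENNReal.add_right_inj ENNReal.ofReal_ne_top).1 hpq
  have hinv : Tendsto (fun t => (qfun f t)⁻¹) (𝓝[>] (0 : ℝ)) (𝓝 q₀⁻¹) :=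
    (continuous_inv.tendsto q₀).comp hq
  have hlt : ENNReal.ofReal κ < q₀⁻¹ := by
    rw [hq0]; exact (ENNReal.ofReal_lt_ofReal_iff_of_nonneg hκ0).2 hκ
  filter_upwards [hinv.eventually (lt_mem_nhds hlt), self_mem_nhdsWithin] with t ht ht0
  have ht0 : 0 < t := ht0
  have hne : f t * deriv (deriv f) t ≠ 0 := by
    intro h0
    simp [qfun, h0] at ht
  have hD : 0 < f t * deriv (deriv f) t :=
    lt_of_le_of_ne (mul_nonneg (hpos t ht0).le (hf2 t ht0)) hne.symm
  rw [qfun, if_neg hne] at ht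
  rcases (sq_nonneg (deriv f t)).eq_or_lt with h0 | h0
  · rw [← h0]; simpa using hD.le
  · rw [← ENNReal.ofReal_inv_of_pos (by positivity),
      ENNReal.ofReal_lt_ofReal_iff_of_nonneg hκ0, inv_div, lt_div_iff₀ h0] at ht
    exact ht.le

set_option maxHeartbeats 1600000 in
/-- Two functions of `u` which, inserted in the stability inequality and in the equation, give a
weighted energy estimate with a positive remainder. -/
lemma exists_test_functions {f : ℝ → ℝ} {p a κ ε M : ℝ} (hp : 1 < p) (ha : 1 < a)
    (hκ : (a / p - 1) ^ 2 < κ) (hε : 0 < ε)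
    (hC2 : ContDiffOn ℝ 2 f (Set.Ioi 0)) (hpos : ∀ t, 0 < t → 0 < f t)
    (hf2 : ∀ t, 0 < t → 0 ≤ deriv (deriv f) t)
    (hq : ∀ t, 0 < t → t < ε → κ * deriv f t ^ 2 ≤ f t * deriv (deriv f) t)
    {c C : ℝ} (hc : 0 < c) (hC : 0 < C)
    (hlow : ∀ t, 0 < t → t ≤ M → c * t ^ p ≤ f t)
    (hupp : ∀ t, 0 < t → t ≤ M → f t ≤ C * t ^ p)
    (hlow' : ∀ t, 0 < t → t ≤ M → f t ≤ t * deriv f t)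
    (hupp' : ∀ t, 0 < t → t ≤ M → t * deriv f t ≤ C * f t) :
    ∃ (g g' G G' : ℝ → ℝ) (δ B : ℝ), 0 < δ ∧ 0 < B ∧
      (∀ t, 0 < t → HasDerivAt g (g' t) t) ∧ (∀ t, 0 < t → HasDerivAt G (G' t) t) ∧
      ContinuousOn g' (Set.Ioi 0) ∧ ContinuousOn G' (Set.Ioi 0) ∧
      ∀ t, 0 < t → t ≤ M →
        δ * (t ^ (a - 1)) ^ 2 ≤ G' t - g' t ^ 2 ∧
        δ * t ^ (p - 1) * (t * t ^ (a - 1)) ^ 2 ≤ deriv f t * g t ^ 2 - f t * G t ∧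
        |g t| ≤ B * (t * t ^ (a - 1)) ∧
        |g t * g' t - G t| ≤ B * (t * (t ^ (a - 1)) ^ 2) := by
  have hp0 : 0 < p := by linarith
  set α : ℝ := a / p with hα
  have hα0 : 0 < α := by positivity
  have hpα : p * α = a := by rw [hα]; field_simp
  have hopen : IsOpen (Set.Ioi (0 : ℝ)) := isOpen_Ioi
  have hfd : ∀ t, 0 < t → HasDerivAt f (deriv f t) t := fun t ht =>
    ((hC2.contDiffAt (Ioi_mem_nhds ht)).differentiableAt (by norm_num)).hasDerivAt
  have hC1 : ContDiffOn ℝ 1 (deriv f) (Set.Ioi 0) :=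
    ((contDiffOn_succ_iff_deriv_of_isOpen (n := 1) hopen).1
      (by rw [one_add_one_eq_two]; exact hC2)).2.2
  have hf1d : ∀ t, 0 < t → HasDerivAt (deriv f) (deriv (deriv f) t) t := fun t ht =>
    ((hC1.contDiffAt (Ioi_mem_nhds ht)).differentiableAt (by norm_num)).hasDerivAt
  have hf2c : ContinuousOn (deriv (deriv f)) (Set.Ioi 0) :=
    hC1.continuousOn_deriv_of_isOpen hopen (by norm_num)
  have hfc : ContinuousOn f (Set.Ioi 0) := hC2.continuousOn
  have hf1c : ContinuousOn (deriv f) (Set.Ioi 0) := hC1.continuousOn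
  have hfne : ∀ t ∈ Set.Ioi (0 : ℝ), f t ≠ 0 := fun t ht => (hpos t ht).ne'
  -- the cutoff
  set ε₁ : ℝ := ε / 4 with hε₁
  have hε₁0 : 0 < ε₁ := by positivity
  let w : ℝ → ℝ := fun t => max 0 (min 1 (2 - t / ε₁))
  have hwc : Continuous w := by fun_prop
  have hw0 : ∀ t, 0 ≤ w t := fun t => le_max_left _ _
  have hw1 : ∀ t, w t ≤ 1 := fun t => max_le zero_le_one (min_le_left _ _)
  have hwl : ∀ t, t ≤ ε₁ → w t = 1 := by
    intro t ht
    have : t / ε₁ ≤ 1 := (div_le_one hε₁0).2 ht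
    have : min 1 (2 - t / ε₁) = 1 := min_eq_left (by linarith)
    simp [w, this]
  have hwr : ∀ t, 2 * ε₁ ≤ t → w t = 0 := by
    intro t ht
    have : 2 ≤ t / ε₁ := (le_div_iff₀ hε₁0).2 ht
    exact max_eq_left ((min_le_right _ _).trans (by linarith))
  let k : ℝ → ℝ := fun t => (1 - w t) * (deriv f t / f t)
  have hkc : Continuous k := by
    rw [continuous_iff_continuousAt]
    intro t
    rcases lt_or_ge 0 t with ht | ht
    · have h1 : ContinuousOn k (Set.Ioi 0) :=
        (continuousOn_const.sub hwc.continuousOn).mul (hf1c.div hfc hfne)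
      exact h1.continuousAt (Ioi_mem_nhds ht)
    · have : k =ᶠ[𝓝 t] fun _ => (0 : ℝ) := by
        filter_upwards [Iio_mem_nhds (show t < ε₁ by linarith)] with s hs
        simp [k, hwl s (le_of_lt hs)]
      exact continuousAt_const.congr this.symm
  let P : ℝ → ℝ := fun t => ∫ s in ε₁..t, k s
  have hPd : ∀ t, HasDerivAt P (k t) t := fun t =>
    intervalIntegral.integral_hasDerivAt_right (hkc.intervalIntegrable _ _)
      (hkc.stronglyMeasurableAtFilter _ _) hkc.continuousAt
  have hPc : Continuous P := continuous_iff_continuousAt.2 fun t => (hPd t).continuousAt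
  obtain ⟨b₀, hb₀⟩ := (isCompact_Icc (a := (0 : ℝ)) (b := M)).exists_bound_of_continuousOn
    (f := fun t => (1 - α) * P t) (by fun_prop)
  let g : ℝ → ℝ := fun t => f t ^ α * Real.exp ((1 - α) * P t)
  let θ : ℝ → ℝ := fun t => (α - 1) * w t
  have hθ : ∀ t, θ t ^ 2 ≤ (α - 1) ^ 2 := by
    intro t
    have : w t ^ 2 ≤ 1 := pow_le_one₀ (hw0 t) (hw1 t)
    simp only [θ, mul_pow]
    nlinarith [sq_nonneg (α - 1)]
  have hθ' : ∀ t, |θ t| ≤ |α - 1| := fun t => sq_le_sq.1 (hθ t)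
  let y : ℝ → ℝ := fun t => g t * deriv f t / f t
  let g' : ℝ → ℝ := fun t => (1 + θ t) * y t
  have hgd : ∀ t, 0 < t → HasDerivAt g (g' t) t := by
    intro t ht
    have h1 := (hfd t ht).rpow_const (p := α) (Or.inl (hpos t ht).ne')
    have h2 := (((hPd t).const_mul (1 - α))).exp
    refine (h1.mul h2).congr_deriv ?_
    have h3 : f t ^ (α - 1) = f t ^ α / f t := by
      rw [Real.rpow_sub (hpos t ht), Real.rpow_one]
    simp only [g', y, g, θ, k, h3]
    have := (hpos t ht).ne'
    field_simp
    ring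
  let y' : ℝ → ℝ := fun t =>
    g' t * deriv f t / f t + g t * deriv (deriv f) t / f t - g t * deriv f t ^ 2 / f t ^ 2
  have hyd : ∀ t, 0 < t → HasDerivAt y (y' t) t := by
    intro t ht
    refine (((hgd t ht).mul (hf1d t ht)).div (hfd t ht) (hpos t ht).ne').congr_deriv ?_
    simp only [y', Pi.mul_apply]
    have := (hpos t ht).ne'
    field_simp
  have hgc : ContinuousOn g (Set.Ioi 0) := fun t ht =>
    (hgd t ht).continuousAt.continuousWithinAt
  have hyc : ContinuousOn y (Set.Ioi 0) := fun t ht =>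
    (hyd t ht).continuousAt.continuousWithinAt
  have hg'c : ContinuousOn g' (Set.Ioi 0) := by
    have : Continuous θ := by fun_prop
    exact (continuousOn_const.add this.continuousOn).mul hyc
  have hy'c : ContinuousOn y' (Set.Ioi 0) :=
    (((hg'c.mul hf1c).div hfc hfne).add ((hgc.mul hf2c).div hfc hfne)).sub
      ((hgc.mul (hf1c.pow 2)).div (hfc.pow 2) fun t ht => pow_ne_zero 2 (hfne t ht))
  -- the decreasing correction
  set b : ℝ := 2 * a / (2 * ε₁) with hb
  have hb0 : 0 < b := by positivity
  set cl : ℝ := c ^ α * Real.exp (-b₀) with hcl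
  set cu : ℝ := C ^ α * Real.exp b₀ with hcu
  have hcl0 : 0 < cl := by positivity
  have hcu0 : 0 < cu := by positivity
  have hκ' : 0 < κ - (α - 1) ^ 2 := by linarith
  set δ : ℝ := (κ - (α - 1) ^ 2) * cl ^ 2 / (2 * a) with hδ
  have hδ0 : 0 < δ := by positivity
  let e : ℝ → ℝ := fun t => δ * (t ^ (2 * a - 1) * Real.exp (-(b * t)))
  let e' : ℝ → ℝ := fun t => δ * ((2 * a - 1 - b * t) * t ^ (2 * a - 2) * Real.exp (-(b * t)))
  have hed : ∀ t, 0 < t → HasDerivAt e (e' t) t := by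
    intro t ht
    have h1 := Real.hasDerivAt_rpow_const (p := 2 * a - 1) (Or.inl ht.ne')
    have h2 : HasDerivAt (fun t => Real.exp (-(b * t))) (Real.exp (-(b * t)) * -(b * 1)) t :=
      (((hasDerivAt_id' t).const_mul b).neg).exp
    refine ((h1.mul h2).const_mul δ).congr_deriv ?_
    have h3 : t ^ (2 * a - 1) = t ^ (2 * a - 2) * t := by
      rw [← Real.rpow_add_one ht.ne']; congr 1; ring
    have h4 : 2 * a - 1 - 1 = 2 * a - 2 := by ring
    simp only [e', h3, h4]
    ring
  have he'c : ContinuousOn e' (Set.Ioi 0) := by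
    have h1 : ContinuousOn (fun t : ℝ => t ^ (2 * a - 2)) (Set.Ioi 0) := fun t ht =>
      (Real.continuousAt_rpow_const t _ (Or.inl (ne_of_gt ht))).continuousWithinAt
    exact continuousOn_const.mul (((by fun_prop :
      ContinuousOn (fun t : ℝ => 2 * a - 1 - b * t) (Set.Ioi 0)).mul h1).mul (by fun_prop))
  refine ⟨g, g', fun t => y t * g t - e t, fun t => y' t * g t + y t * g' t - e' t,
    min (δ * Real.exp (-(b * M))) (c * (δ * Real.exp (-(b * M)))),
    cu + (|α - 1| * (cu * C) * cu + δ), ?_, by positivity, hgd,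
    fun t ht => ((hyd t ht).mul (hgd t ht)).sub (hed t ht), hg'c,
    ((hy'c.mul hgc).add (hyc.mul hg'c)).sub he'c, ?_⟩
  · exact lt_min (by positivity) (by positivity)
  intro t ht htM
  have hft := hpos t ht
  have hT2 : t ^ (2 * a - 2) = (t ^ (a - 1)) ^ 2 := by
    rw [← Real.rpow_natCast, ← Real.rpow_mul ht.le]; congr 1; push_cast; ring
  have hsplit : ∀ x : ℝ, t ^ x = t * t ^ (x - 1) := by
    intro x
    rw [Real.rpow_sub_one ht.ne']
    field_simp
  have hTt : t ^ (2 * a - 1) = t * (t ^ (a - 1)) ^ 2 := by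
    rw [← hT2, hsplit]; congr 2; ring
  have hta : t ^ a = t * t ^ (a - 1) := hsplit a
  have htp : t ^ p = t * t ^ (p - 1) := hsplit p
  set T : ℝ := t ^ (a - 1) with hT
  have hT0 : 0 < T := by positivity
  have hexp : Real.exp (-b₀) ≤ Real.exp ((1 - α) * P t) ∧
      Real.exp ((1 - α) * P t) ≤ Real.exp b₀ := by
    have := abs_le.1 (hb₀ t ⟨ht.le, htM⟩)
    exact ⟨Real.exp_le_exp.2 this.1, Real.exp_le_exp.2 this.2⟩
  have hfα : c ^ α * (t * T) ≤ f t ^ α ∧ f t ^ α ≤ C ^ α * (t * T) := by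
    have h1 : (t ^ p) ^ α = t * T := by rw [← Real.rpow_mul ht.le, hpα, hta]
    have h2 : 0 ≤ t ^ p := by positivity
    constructor
    · rw [← h1, ← Real.mul_rpow hc.le h2]
      exact Real.rpow_le_rpow (by positivity) (hlow t ht htM) hα0.le
    · rw [← h1, ← Real.mul_rpow hC.le h2]
      exact Real.rpow_le_rpow hft.le (hupp t ht htM) hα0.le
  have hgl : cl * (t * T) ≤ g t := by
    calc cl * (t * T) = c ^ α * (t * T) * Real.exp (-b₀) := by rw [hcl]; ring
      _ ≤ _ := mul_le_mul hfα.1 hexp.1 (by positivity) (by positivity)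
  have hgu : g t ≤ cu * (t * T) := by
    calc g t ≤ C ^ α * (t * T) * Real.exp b₀ :=
          mul_le_mul hfα.2 hexp.2 (by positivity) (by positivity)
      _ = _ := by rw [hcu]; ring
  have hg0 : 0 < g t := by positivity
  have hf1 : 0 ≤ deriv f t := by
    have := hlow' t ht htM
    by_contra! hneg
    exact absurd (this.trans (mul_nonpos_of_nonneg_of_nonpos ht.le hneg.le)) (not_le.2 hft)
  have hyl : cl * T ≤ y t := by
    have h1 : cl * T * f t ≤ g t * deriv f t := by
      have h2 : g t * f t ≤ g t * (t * deriv f t) :=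
        mul_le_mul_of_nonneg_left (hlow' t ht htM) hg0.le
      have h3 : cl * (t * T) * f t ≤ g t * f t := mul_le_mul_of_nonneg_right hgl hft.le
      have h4 : t * (cl * T * f t) ≤ t * (g t * deriv f t) := by linarith
      exact le_of_mul_le_mul_left h4 ht
    exact (le_div_iff₀ hft).2 h1
  have hyu : y t ≤ cu * C * T := by
    have h1 : g t * deriv f t ≤ cu * C * T * f t := by
      have h2 : cu * T * (t * deriv f t) ≤ cu * T * (C * f t) :=
        mul_le_mul_of_nonneg_left (hupp' t ht htM) (by positivity)
      have h3 : g t * deriv f t ≤ cu * (t * T) * deriv f t :=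
        mul_le_mul_of_nonneg_right hgu hf1
      linarith
    exact (div_le_iff₀ hft).2 h1
  have hy0 : 0 < y t := lt_of_lt_of_le (by positivity) hyl
  have hexpM : Real.exp (-(b * M)) ≤ Real.exp (-(b * t)) := by
    exact Real.exp_le_exp.2 (neg_le_neg (mul_le_mul_of_nonneg_left htM hb0.le))
  have hexp1 : Real.exp (-(b * t)) ≤ 1 := by
    exact Real.exp_le_one_iff.2 (neg_nonpos.2 (mul_pos hb0 ht).le)
  have het : e t = δ * (t * T ^ 2 * Real.exp (-(b * t))) := by simp only [e, hTt]
  have he't : e' t = δ * ((2 * a - 1 - b * t) * T ^ 2 * Real.exp (-(b * t))) := by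
    simp only [e', hT2]
  refine ⟨?_, ?_, ?_, ?_⟩
  · have hid : y' t * g t + y t * g' t - e' t - g' t ^ 2 =
        g t ^ 2 * deriv (deriv f) t / f t - θ t ^ 2 * y t ^ 2 - e' t := by
      simp only [y', g', y]
      field_simp
      ring
    rw [hid]
    refine (mul_le_mul_of_nonneg_right (min_le_left _ _) (by positivity)).trans ?_
    rcases lt_or_ge t (2 * ε₁) with hlt | hge
    · have h1 : κ * y t ^ 2 ≤ g t ^ 2 * deriv (deriv f) t / f t := by
        have h2 := hq t ht (by rw [hε₁] at hlt; linarith)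
        have h3 : g t ^ 2 * deriv (deriv f) t / f t =
            (g t / f t) ^ 2 * (f t * deriv (deriv f) t) := by field_simp
        have h4 : κ * y t ^ 2 = (g t / f t) ^ 2 * (κ * deriv f t ^ 2) := by
          simp only [y]; ring
        rw [h3, h4]
        exact mul_le_mul_of_nonneg_left h2 (by positivity)
      have h2 : (κ - (α - 1) ^ 2) * (cl * T) ^ 2 ≤ (κ - θ t ^ 2) * y t ^ 2 := by
        have := hθ t
        have h3 : (cl * T) ^ 2 ≤ y t ^ 2 := pow_le_pow_left₀ (by positivity) hyl 2
        exact mul_le_mul (by linarith) h3 (by positivity) (by linarith)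
      have h3 : (κ - (α - 1) ^ 2) * (cl * T) ^ 2 = δ * (2 * a) * T ^ 2 := by
        rw [hδ]; field_simp
      have h4 : e' t ≤ δ * (2 * a - 1) * T ^ 2 := by
        rw [he't]
        have h5 : (2 * a - 1 - b * t) * T ^ 2 * Real.exp (-(b * t)) ≤ (2 * a - 1) * T ^ 2 := by
          have h6 : (2 * a - 1 - b * t) * (T ^ 2 * Real.exp (-(b * t))) ≤
              (2 * a - 1) * (T ^ 2 * Real.exp (-(b * t))) :=
            mul_le_mul_of_nonneg_right (by linarith [mul_pos hb0 ht]) (by positivity)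
          have h7 : T ^ 2 * Real.exp (-(b * t)) ≤ T ^ 2 :=
            mul_le_of_le_one_right (by positivity) hexp1
          have h8 := mul_le_mul_of_nonneg_left h7 (show 0 ≤ 2 * a - 1 by linarith)
          linarith
        have := mul_le_mul_of_nonneg_left h5 hδ0.le
        linarith
      have h5 : δ * Real.exp (-(b * M)) * T ^ 2 ≤ δ * T ^ 2 := by
        have : Real.exp (-(b * M)) ≤ 1 := hexpM.trans hexp1
        have := mul_le_mul_of_nonneg_left this (show 0 ≤ δ * T ^ 2 by positivity)
        linarith
      linarith
    · have hθ0 : θ t = 0 := by simp [θ, hwr t hge]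
      have h1 : 0 ≤ g t ^ 2 * deriv (deriv f) t / f t := by
        have := hf2 t ht; positivity
      have h2 : 2 * a ≤ b * t := by
        calc 2 * a = b * (2 * ε₁) := by rw [hb]; field_simp
          _ ≤ b * t := by gcongr
      have h3 : δ * Real.exp (-(b * M)) * T ^ 2 ≤ -e' t := by
        rw [he't]
        have h4 : δ * T ^ 2 * Real.exp (-(b * M)) ≤ δ * T ^ 2 * Real.exp (-(b * t)) := by gcongr
        have h5 : 0 ≤ δ * T ^ 2 * Real.exp (-(b * t)) := by positivity
        have h6 : 1 * (δ * T ^ 2 * Real.exp (-(b * t))) ≤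
            (b * t - (2 * a - 1)) * (δ * T ^ 2 * Real.exp (-(b * t))) :=
          mul_le_mul_of_nonneg_right (by linarith) h5
        linarith
      rw [hθ0]
      linarith
  · have hid : deriv f t * g t ^ 2 - f t * (y t * g t - e t) = f t * e t := by
      simp only [y]
      field_simp
      ring
    rw [hid, het]
    calc _ ≤ c * (δ * Real.exp (-(b * M))) * t ^ (p - 1) * (t * T) ^ 2 := by
          gcongr; exact min_le_right _ _
      _ = c * t ^ p * (δ * (t * T ^ 2 * Real.exp (-(b * M)))) := by rw [htp]; ring
      _ ≤ f t * (δ * (t * T ^ 2 * Real.exp (-(b * t)))) := by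
          gcongr
          exact hlow t ht htM
  · rw [abs_of_pos hg0]
    refine hgu.trans ?_
    have : 0 ≤ |α - 1| * (cu * C) * cu + δ := by positivity
    exact mul_le_mul_of_nonneg_right (by linarith) (by positivity)
  · have hid : g t * g' t - (y t * g t - e t) = θ t * (y t * g t) + e t := by
      simp only [g']; ring
    rw [hid]
    calc |θ t * (y t * g t) + e t| ≤ |θ t| * (y t * g t) + e t := by
          refine (abs_add_le _ _).trans ?_
          have : 0 ≤ e t := by rw [het]; positivity
          rw [abs_mul, abs_of_pos (mul_pos hy0 hg0), abs_of_nonneg this]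
      _ ≤ |α - 1| * (cu * C * T * (cu * (t * T))) + δ * (t * T ^ 2 * 1) := by
          rw [het]
          refine add_le_add (mul_le_mul (hθ' t) (mul_le_mul hyu hgu hg0.le (by positivity))
            (by positivity) (abs_nonneg _)) (by gcongr)
      _ = (|α - 1| * (cu * C) * cu + δ) * (t * T ^ 2) := by ring
      _ ≤ _ := by
          exact mul_le_mul_of_nonneg_right (by linarith) (by positivity)

section Energy

variable {N : ℕ}

lemma gradient_apply_eq_fderiv (u : EuclideanSpace ℝ (Fin N) → ℝ) (x : EuclideanSpace ℝ (Fin N))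
    (i : Fin N) : gradient u x i = fderiv ℝ u x (EuclideanSpace.single i 1) := by
  have h : inner ℝ (gradient u x) (EuclideanSpace.single i (1 : ℝ)) =
      fderiv ℝ u x (EuclideanSpace.single i 1) := by
    rw [gradient, InnerProductSpace.toDual_symm_apply]
  rw [← h, EuclideanSpace.inner_single_right]
  simp

lemma norm_gradient_eq (u : EuclideanSpace ℝ (Fin N) → ℝ) (x : EuclideanSpace ℝ (Fin N)) :
    ‖gradient u x‖ = ‖fderiv ℝ u x‖ := by
  rw [gradient, LinearIsometryEquiv.norm_map]

lemma continuous_gradient {u : EuclideanSpace ℝ (Fin N) → ℝ} (hu : ContDiff ℝ 1 u) :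
    Continuous (gradient u) :=
  (InnerProductSpace.toDual ℝ _).symm.continuous.comp (hu.continuous_fderiv (by norm_num))

lemma gradient_eq_zero_of_notMem_tsupport {ξ : EuclideanSpace ℝ (Fin N) → ℝ}
    {x : EuclideanSpace ℝ (Fin N)} (hx : x ∉ tsupport ξ) : gradient ξ x = 0 := by
  rw [gradient, fderiv_of_notMem_tsupport ℝ hx, map_zero]

lemma contDiffOn_one_of_hasDerivAt {g g' : ℝ → ℝ} (hg : ∀ t, 0 < t → HasDerivAt g (g' t) t)
    (hg' : ContinuousOn g' (Set.Ioi 0)) : ContDiffOn ℝ 1 g (Set.Ioi 0) := by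
  rw [show (1 : WithTop ℕ∞) = 0 + 1 by simp, contDiffOn_succ_iff_deriv_of_isOpen isOpen_Ioi]
  refine ⟨fun t ht => (hg t ht).differentiableAt.differentiableWithinAt, by simp, ?_⟩
  rw [contDiffOn_zero]
  exact hg'.congr fun t ht => (hg t ht).deriv

/-- Green's formula against a compactly supported function. -/
lemma integral_neg_lap_mul {u ψ : EuclideanSpace ℝ (Fin N) → ℝ} (hu : ContDiff ℝ 2 u)
    (hψ : ContDiff ℝ 1 ψ) (hs : HasCompactSupport ψ) :
    ∫ x, -lap u x * ψ x = ∫ x, inner ℝ (gradient u x) (gradient ψ x) := by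
  let D : Fin N → EuclideanSpace ℝ (Fin N) → ℝ := fun i x =>
    fderiv ℝ u x (EuclideanSpace.single i 1)
  have hfu : ContDiff ℝ 1 (fderiv ℝ u) := hu.fderiv_right (by norm_num)
  have hD : ∀ i, ContDiff ℝ 1 (D i) := fun i => hfu.clm_apply contDiff_const
  have hDf : ∀ i x, fderiv ℝ (D i) x (EuclideanSpace.single i 1) =
      iteratedFDeriv ℝ 2 u x ![EuclideanSpace.single i 1, EuclideanSpace.single i 1] := by
    intro i x
    have h1 : HasFDerivAt (D i) _ x := (ContinuousLinearMap.apply ℝ ℝ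
      (EuclideanSpace.single i (1 : ℝ))).hasFDerivAt.comp x
        ((hfu.differentiable (by norm_num)) x).hasFDerivAt
    rw [h1.fderiv, iteratedFDeriv_two_apply]
    rfl
  have hDc : ∀ i, Continuous fun x => fderiv ℝ (D i) x (EuclideanSpace.single i 1) := fun i =>
    ((hD i).continuous_fderiv (by norm_num)).clm_apply continuous_const
  have hψc : ∀ i : Fin N, Continuous fun x => fderiv ℝ ψ x (EuclideanSpace.single i 1) := fun i =>
    (hψ.continuous_fderiv (by norm_num)).clm_apply continuous_const
  have hψs : ∀ i : Fin N, HasCompactSupport fun x => fderiv ℝ ψ x (EuclideanSpace.single i 1) :=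
    fun i => hs.fderiv_apply ℝ _
  have hI1 : ∀ i, Integrable fun x => fderiv ℝ (D i) x (EuclideanSpace.single i 1) * ψ x :=
    fun i => ((hDc i).mul hψ.continuous).integrable_of_hasCompactSupport hs.mul_left
  have hI2 : ∀ i, Integrable fun x => D i x * fderiv ℝ ψ x (EuclideanSpace.single i 1) :=
    fun i => ((hD i).continuous.mul (hψc i)).integrable_of_hasCompactSupport (hψs i).mul_left
  have hI3 : ∀ i, Integrable fun x => D i x * ψ x :=
    fun i => ((hD i).continuous.mul hψ.continuous).integrable_of_hasCompactSupport hs.mul_left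
  have hibp := fun i => integral_mul_fderiv_eq_neg_fderiv_mul_of_integrable (hI1 i) (hI2 i) (hI3 i)
    (fun x _ => (hD i).differentiable (by norm_num) x)
    (fun x _ => hψ.differentiable (by norm_num) x)
  calc ∫ x, -lap u x * ψ x
      = ∫ x, -∑ i, fderiv ℝ (D i) x (EuclideanSpace.single i 1) * ψ x := by
        congr 1; ext x
        simp only [lap, hDf, Finset.sum_mul, neg_mul]
    _ = ∑ i, ∫ x, D i x * fderiv ℝ ψ x (EuclideanSpace.single i 1) := by
        rw [integral_neg, integral_finsetSum _ fun i _ => hI1 i, ← Finset.sum_neg_distrib]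
        exact Finset.sum_congr rfl fun i _ => (hibp i).symm
    _ = ∫ x, inner ℝ (gradient u x) (gradient ψ x) := by
        rw [← integral_finsetSum _ fun i _ => hI2 i]
        congr 1; ext x
        rw [PiLp.inner_apply]
        refine Finset.sum_congr rfl fun i _ => ?_
        simp [gradient_apply_eq_fderiv, D, mul_comm]

lemma gradient_comp_mul {g : ℝ → ℝ} {c : ℝ} {u ξ : EuclideanSpace ℝ (Fin N) → ℝ}
    {x : EuclideanSpace ℝ (Fin N)} (hg : HasDerivAt g c (u x))
    (hu : DifferentiableAt ℝ u x) (hξ : DifferentiableAt ℝ ξ x) :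
    gradient (fun y => g (u y) * ξ y) x =
      (c * ξ x) • gradient u x + g (u x) • gradient ξ x := by
  have h := (hg.comp_hasFDerivAt x hu.hasFDerivAt).mul hξ.hasFDerivAt
  have h2 : fderiv ℝ (fun y => g (u y) * ξ y) x = _ := h.fderiv
  rw [gradient, h2, gradient, gradient]
  simp only [map_add, map_smulₛₗ, Function.comp, smul_smul]
  simp [mul_comm, add_comm]

/-- The pointwise inequality behind the energy estimate. -/
lemma norm_sq_sub_inner_le {E : Type*} [NormedAddCommGroup E] [InnerProductSpace ℝ E]
    {δ B t T ξ g g' G G' : ℝ} (hδ : 0 < δ)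
    (h1 : δ * T ^ 2 ≤ G' - g' ^ 2) (h3 : |g| ≤ B * (t * T))
    (h4 : |g * g' - G| ≤ B * (t * T ^ 2)) (U X : E) :
    ‖(g' * ξ) • U + g • X‖ ^ 2 - inner ℝ U ((G' * ξ ^ 2) • U + G • ((2 * ξ) • X)) ≤
      (B ^ 2 / δ + B ^ 2) * ((t * T) ^ 2 * ‖X‖ ^ 2) := by
  have hexp : ‖(g' * ξ) • U + g • X‖ ^ 2 - inner ℝ U ((G' * ξ ^ 2) • U + G • ((2 * ξ) • X)) =
      (g' ^ 2 - G') * (ξ ^ 2 * ‖U‖ ^ 2) + (g * g' - G) * (2 * (ξ * inner ℝ U X)) +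
        g ^ 2 * ‖X‖ ^ 2 := by
    rw [norm_add_sq_real, norm_smul, norm_smul, inner_add_right]
    simp only [inner_smul_right, inner_smul_left, real_inner_self_eq_norm_sq, mul_pow,
      Real.norm_eq_abs, sq_abs, conj_trivial]
    ring
  have hcs : |ξ * inner ℝ U X| ≤ |ξ| * (‖U‖ * ‖X‖) := by
    rw [abs_mul]; gcongr; exact abs_real_inner_le_norm U X
  have hmid : (g * g' - G) * (2 * (ξ * inner ℝ U X)) ≤
      B * (t * T ^ 2) * (2 * (|ξ| * (‖U‖ * ‖X‖))) := by
    refine (le_abs_self _).trans ?_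
    rw [abs_mul, abs_mul (2 : ℝ), abs_two]
    exact mul_le_mul h4 (by linarith) (by positivity) ((abs_nonneg _).trans h4)
  have hg2 : g ^ 2 ≤ (B * (t * T)) ^ 2 := sq_le_sq' (abs_le.1 h3).1 (abs_le.1 h3).2
  have hlast : g ^ 2 * ‖X‖ ^ 2 ≤ (B * (t * T)) ^ 2 * ‖X‖ ^ 2 := by gcongr
  have hfirst : (g' ^ 2 - G') * (ξ ^ 2 * ‖U‖ ^ 2) ≤ -(δ * T ^ 2) * (|ξ| ^ 2 * ‖U‖ ^ 2) := by
    rw [sq_abs]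
    exact mul_le_mul_of_nonneg_right (by linarith) (by positivity)
  have hyoung : 0 ≤ T ^ 2 * ((δ * (|ξ| * ‖U‖) - B * t * ‖X‖) ^ 2 / δ) := by positivity
  have hyoung' : T ^ 2 * ((δ * (|ξ| * ‖U‖) - B * t * ‖X‖) ^ 2 / δ) =
      δ * T ^ 2 * (|ξ| ^ 2 * ‖U‖ ^ 2) - B * (t * T ^ 2) * (2 * (|ξ| * (‖U‖ * ‖X‖))) +
        B ^ 2 / δ * ((t * T) ^ 2 * ‖X‖ ^ 2) := by
    field_simp
    ring
  rw [hexp]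
  linarith

/-- The weighted energy estimate for solutions that are stable outside `K`. -/
lemma energy_estimate {f f₁ g g' G G' : ℝ → ℝ} {p a δ B M : ℝ} (hδ : 0 < δ)
    {u ξ : EuclideanSpace ℝ (Fin N) → ℝ} {K : Set (EuclideanSpace ℝ (Fin N))}
    (hu : ContDiff ℝ 2 u) (hupos : ∀ x, 0 < u x) (huM : ∀ x, u x ≤ M)
    (hsol : ∀ x, -lap u x = f (u x)) (hstab : StableOutside f₁ u K)
    (hfc : ContinuousOn f (Set.Ioi 0)) (hf₁c : ContinuousOn f₁ (Set.Ioi 0))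
    (hg : ∀ t, 0 < t → HasDerivAt g (g' t) t) (hG : ∀ t, 0 < t → HasDerivAt G (G' t) t)
    (hg' : ContinuousOn g' (Set.Ioi 0)) (hG' : ContinuousOn G' (Set.Ioi 0))
    (h : ∀ t, 0 < t → t ≤ M →
        δ * (t ^ (a - 1)) ^ 2 ≤ G' t - g' t ^ 2 ∧
        δ * t ^ (p - 1) * (t * t ^ (a - 1)) ^ 2 ≤ f₁ t * g t ^ 2 - f t * G t ∧
        |g t| ≤ B * (t * t ^ (a - 1)) ∧
        |g t * g' t - G t| ≤ B * (t * (t ^ (a - 1)) ^ 2))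
    (hξ : ContDiff ℝ 1 ξ) (hξs : HasCompactSupport ξ) (hξK : tsupport ξ ⊆ Kᶜ) :
    ∫ x, δ * u x ^ (p - 1) * (u x * u x ^ (a - 1)) ^ 2 * ξ x ^ 2 ≤
      ∫ x, (B ^ 2 / δ + B ^ 2) * ((u x * u x ^ (a - 1)) ^ 2 * ‖gradient ξ x‖ ^ 2) := by
  have hu1 : ContDiff ℝ 1 u := hu.of_le (by norm_num)
  have hmem : ∀ x, u x ∈ Set.Ioi (0 : ℝ) := hupos
  have hud : Differentiable ℝ u := hu1.differentiable (by norm_num)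
  have hξd : Differentiable ℝ ξ := hξ.differentiable (by norm_num)
  have hgC := contDiffOn_one_of_hasDerivAt hg hg'
  have hGC := contDiffOn_one_of_hasDerivAt hG hG'
  have hgu : ContDiff ℝ 1 fun x => g (u x) := contDiffOn_univ.1
    (hgC.comp hu1.contDiffOn fun x _ => hmem x)
  have hGu : ContDiff ℝ 1 fun x => G (u x) := contDiffOn_univ.1
    (hGC.comp hu1.contDiffOn fun x _ => hmem x)
  have hg'u : Continuous fun x => g' (u x) := hg'.comp_continuous hu.continuous hmem
  have hG'u : Continuous fun x => G' (u x) := hG'.comp_continuous hu.continuous hmem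
  have hfu : Continuous fun x => f (u x) := hfc.comp_continuous hu.continuous hmem
  have hf₁u : Continuous fun x => f₁ (u x) := hf₁c.comp_continuous hu.continuous hmem
  have hpow : ∀ s : ℝ, Continuous fun x => u x ^ s := fun s =>
    hu.continuous.rpow_const fun x => Or.inl (hupos x).ne'
  have hcu := hu.continuous
  have hcξ := hξ.continuous
  have hcgu := continuous_gradient hu1
  have hcgξ := continuous_gradient hξ
  have hguc := hgu.continuous
  have hGuc := hGu.continuous
  have hp1 := hpow (p - 1)
  have ha1 := hpow (a - 1)
  have hintegrable : ∀ F : EuclideanSpace ℝ (Fin N) → ℝ, Continuous F →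
      (∀ x, ξ x = 0 → gradient ξ x = 0 → F x = 0) → Integrable F := by
    intro F hF h0
    refine hF.integrable_of_hasCompactSupport (HasCompactSupport.intro hξs fun x hx => ?_)
    exact h0 x (image_eq_zero_of_notMem_tsupport hx) (gradient_eq_zero_of_notMem_tsupport hx)
  have hst := hstab (fun x => g (u x) * ξ x) (hgu.mul hξ) hξs.mul_left
    ((tsupport_mul_subset_right).trans hξK)
  have hgr := integral_neg_lap_mul (ψ := fun x => G (u x) * ξ x ^ 2) hu (hGu.mul (hξ.pow 2))
    (hξs.comp_left (g := fun s : ℝ => s ^ 2) (by simp)).mul_left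
  have hgradg : ∀ x, gradient (fun y => g (u y) * ξ y) x =
      (g' (u x) * ξ x) • gradient u x + g (u x) • gradient ξ x := fun x =>
    gradient_comp_mul (hg _ (hupos x)) (hud x) (hξd x)
  have hgradξ : ∀ x, gradient (fun y => ξ y ^ 2) x = (2 * ξ x) • gradient ξ x := by
    intro x
    have h1 := gradient_comp_mul (g := id) (hasDerivAt_id (ξ x)) (hξd x) (hξd x)
    simp only [id] at h1
    rw [show (fun y => ξ y ^ 2) = fun y => ξ y * ξ y from funext fun y => sq _, h1, ← add_smul]
    congr 1; ring
  have hgradG : ∀ x, gradient (fun y => G (u y) * ξ y ^ 2) x =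
      (G' (u x) * ξ x ^ 2) • gradient u x + G (u x) • ((2 * ξ x) • gradient ξ x) := by
    intro x
    have h1 := gradient_comp_mul (ξ := fun y => ξ y ^ 2) (hG _ (hupos x)) (hud x) ((hξd x).pow 2)
    rw [h1, hgradξ]
  simp only [hgradg] at hst
  simp only [hgradG, hsol] at hgr
  have hi1 : Integrable fun x => f₁ (u x) * (g (u x) * ξ x) ^ 2 :=
    hintegrable _ (hf₁u.mul ((hguc.mul hcξ).pow 2)) fun x h0 _ => by simp [h0]
  have hi2 : Integrable fun x => f (u x) * (G (u x) * ξ x ^ 2) :=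
    hintegrable _ (hfu.mul (hGuc.mul (hcξ.pow 2))) fun x h0 _ => by simp [h0]
  have hi3 : Integrable fun x =>
      ‖(g' (u x) * ξ x) • gradient u x + g (u x) • gradient ξ x‖ ^ 2 :=
    hintegrable _ ((((hg'u.mul hcξ).smul hcgu).add (hguc.smul hcgξ)).norm.pow 2)
      fun x h0 h1 => by simp [h0, h1]
  have hi4 : Integrable fun x => inner ℝ (gradient u x)
      ((G' (u x) * ξ x ^ 2) • gradient u x + G (u x) • ((2 * ξ x) • gradient ξ x)) :=
    hintegrable _ (hcgu.inner (((hG'u.mul (hcξ.pow 2)).smul hcgu).add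
      (hGuc.smul ((continuous_const.mul hcξ).smul hcgξ)))) fun x h0 h1 => by simp [h0, h1]
  calc ∫ x, δ * u x ^ (p - 1) * (u x * u x ^ (a - 1)) ^ 2 * ξ x ^ 2
      ≤ ∫ x, (f₁ (u x) * (g (u x) * ξ x) ^ 2 - f (u x) * (G (u x) * ξ x ^ 2)) := by
        refine integral_mono (hintegrable _ (((continuous_const.mul hp1).mul
          ((hcu.mul ha1).pow 2)).mul (hcξ.pow 2)) fun x h0 _ => by simp [h0]) (hi1.sub hi2)
          fun x => ?_
        have := mul_le_mul_of_nonneg_right (h (u x) (hupos x) (huM x)).2.1 (sq_nonneg (ξ x))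
        simp only
        linarith
    _ = (∫ x, f₁ (u x) * (g (u x) * ξ x) ^ 2) - ∫ x, f (u x) * (G (u x) * ξ x ^ 2) :=
        integral_sub hi1 hi2
    _ ≤ _ := sub_le_sub hst hgr.ge
    _ = _ := (integral_sub hi3 hi4).symm
    _ ≤ _ := by
        refine integral_mono (hi3.sub hi4) (hintegrable _ (continuous_const.mul
          (((hcu.mul ha1).pow 2).mul (hcgξ.norm.pow 2))) fun x _ h1 => by simp [h1])
          fun x => ?_
        obtain ⟨h1, -, h3, h4⟩ := h (u x) (hupos x) (huM x)
        exact norm_sq_sub_inner_le hδ h1 h3 h4 _ _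

end Energy

section Cutoff

variable {N : ℕ}

lemma exists_pow_mul_sq_le (n : ℕ) {δ : ℝ} (hδ : 0 < δ) :
    ∃ C : ℝ, 0 < C ∧ ∀ x y : ℝ, 0 ≤ x → 0 ≤ y →
      x ^ n * y ^ 2 ≤ δ * x ^ (n + 2) + C * y ^ (n + 2) := by
  set s := √δ with hs
  have hs0 : 0 < s := Real.sqrt_pos.2 hδ
  have hs2 : s ^ 2 = δ := Real.sq_sqrt hδ.le
  refine ⟨(s⁻¹) ^ n, by positivity, fun x y hx hy => ?_⟩
  rcases le_total y (s * x) with h | h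
  · have h1 : x ^ n * y ^ 2 ≤ x ^ n * (s * x) ^ 2 := by gcongr
    have h2 : x ^ n * (s * x) ^ 2 = δ * x ^ (n + 2) := by rw [mul_pow, hs2]; ring
    have h3 : 0 ≤ (s⁻¹) ^ n * y ^ (n + 2) := by positivity
    linarith
  · have h0 : x ≤ s⁻¹ * y := by rwa [inv_mul_eq_div, le_div_iff₀' hs0]
    have h1 : x ^ n * y ^ 2 ≤ (s⁻¹ * y) ^ n * y ^ 2 := by gcongr
    have h2 : (s⁻¹ * y) ^ n * y ^ 2 = (s⁻¹) ^ n * y ^ (n + 2) := by rw [mul_pow]; ring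
    have h3 : 0 ≤ δ * x ^ (n + 2) := by positivity
    linarith

/-- Cutoffs on annuli whose gradients are bounded in the conformally invariant norm. -/
lemma exists_annulus_cutoff (hN : N ≠ 0) {R₀ : ℝ} (hR₀ : 0 < R₀) :
    ∃ A : ℝ, 0 ≤ A ∧ ∀ R : ℝ, 2 * R₀ ≤ R → ∃ η : EuclideanSpace ℝ (Fin N) → ℝ,
      ContDiff ℝ 1 η ∧ HasCompactSupport η ∧ tsupport η ⊆ (Metric.ball 0 R₀)ᶜ ∧
      (∀ x, 0 ≤ η x) ∧ (∀ x, η x ≤ 1) ∧ (∀ x, 2 * R₀ ≤ ‖x‖ → ‖x‖ ≤ R → η x = 1) ∧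
      ∫ x, ‖gradient η x‖ ^ N ≤ A := by
  obtain ⟨ψ, hψ1, hψ2⟩ : ∃ ψ : ContDiffBump (0 : EuclideanSpace ℝ (Fin N)),
      ψ.rIn = 1 ∧ ψ.rOut = 2 := ⟨⟨1, 2, one_pos, one_lt_two⟩, rfl, rfl⟩
  have hψC : ContDiff ℝ 1 ψ := ψ.contDiff
  have hone : ∀ {R : ℝ} {x : EuclideanSpace ℝ (Fin N)}, 0 < R → ‖x‖ ≤ R → ψ (R⁻¹ • x) = 1 := by
    intro R x hR hx
    refine ψ.one_of_mem_closedBall ?_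
    rw [mem_closedBall_zero_iff, norm_smul, hψ1, Real.norm_of_nonneg (by positivity),
      inv_mul_le_iff₀ hR]
    linarith
  have hzero : ∀ {R : ℝ} {x : EuclideanSpace ℝ (Fin N)}, 0 < R → 2 * R ≤ ‖x‖ →
      ψ (R⁻¹ • x) = 0 := by
    intro R x hR hx
    refine ψ.zero_of_le_dist ?_
    rw [dist_zero_right, norm_smul, hψ2, Real.norm_of_nonneg (by positivity),
      le_inv_mul_iff₀ hR]
    linarith
  have hscale : ∀ R : ℝ, ContDiff ℝ 1 fun x : EuclideanSpace ℝ (Fin N) => ψ (R⁻¹ • x) :=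
    fun R => hψC.comp (contDiff_const_smul _)
  set I := ∫ x, ‖fderiv ℝ ψ x‖ ^ N with hI
  have hI0 : 0 ≤ I := integral_nonneg fun x => by positivity
  have hscaleI : ∀ R : ℝ, 0 < R →
      ∫ x, ‖fderiv ℝ (fun y : EuclideanSpace ℝ (Fin N) => ψ (R⁻¹ • y)) x‖ ^ N = I := by
    intro R hR
    have h1 : ∀ x : EuclideanSpace ℝ (Fin N), ‖fderiv ℝ (fun y => ψ (R⁻¹ • y)) x‖ ^ N =
        (R⁻¹) ^ N * ‖fderiv ℝ ψ (R⁻¹ • x)‖ ^ N := by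
      intro x
      rw [fderiv_comp_smul, norm_smul, mul_pow, Real.norm_of_nonneg (by positivity)]
    simp_rw [h1]
    rw [integral_const_mul, Measure.integral_comp_inv_smul_of_nonneg volume
      (fun x => ‖fderiv ℝ ψ x‖ ^ N) hR.le, finrank_euclideanSpace_fin, smul_eq_mul, ← mul_assoc,
      ← mul_pow, inv_mul_cancel₀ hR.ne', one_pow, one_mul]
  have hcs : ∀ R : ℝ, 0 < R →
      HasCompactSupport fun x : EuclideanSpace ℝ (Fin N) => ψ (R⁻¹ • x) := by
    intro R hR
    refine HasCompactSupport.intro (isCompact_closedBall 0 (2 * R)) fun x hx => hzero hR ?_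
    rw [mem_closedBall_zero_iff, not_le] at hx
    exact hx.le
  refine ⟨2 ^ (N - 1) * (I + I), by positivity, fun R hR => ?_⟩
  have hR0 : 0 < R := by linarith
  set P : EuclideanSpace ℝ (Fin N) → ℝ := fun x => ψ (R⁻¹ • x) with hP
  set Q : EuclideanSpace ℝ (Fin N) → ℝ := fun x => ψ (R₀⁻¹ • x) with hQ
  have hPd : Differentiable ℝ P := (hscale R).differentiable (by norm_num)
  have hQd : Differentiable ℝ Q := (hscale R₀).differentiable (by norm_num)
  have hP0 : ∀ x, 0 ≤ P x := fun x => ψ.nonneg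
  have hP1 : ∀ x, P x ≤ 1 := fun x => ψ.le_one
  have hQ0 : ∀ x, 0 ≤ Q x := fun x => ψ.nonneg
  have hQ1 : ∀ x, Q x ≤ 1 := fun x => ψ.le_one
  have hintegrable : ∀ r : ℝ, 0 < r → Integrable fun x =>
      ‖fderiv ℝ (fun y : EuclideanSpace ℝ (Fin N) => ψ (r⁻¹ • y)) x‖ ^ N := by
    intro r hr
    refine (((hscale r).continuous_fderiv (by norm_num)).norm.pow N).integrable_of_hasCompactSupport
      (((hcs r hr).fderiv ℝ).comp_left (g := fun L => ‖L‖ ^ N) ?_)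
    simp [hN]
  refine ⟨fun x => P x * (1 - Q x), (hscale R).mul (contDiff_const.sub (hscale R₀)),
    (hcs R hR0).mul_right, ?_, fun x => mul_nonneg (hP0 x) (by linarith [hQ1 x]),
    fun x => mul_le_one₀ (hP1 x) (by linarith [hQ1 x]) (by linarith [hQ0 x]), ?_, ?_⟩
  · refine closure_minimal (fun x hx hxb => hx ?_) Metric.isOpen_ball.isClosed_compl
    rw [mem_ball_zero_iff] at hxb
    simp only [hQ, hone hR₀ hxb.le]
    ring
  · intro x h1 h2
    simp only [hP, hQ, hone hR0 h2, hzero hR₀ h1]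
    ring
  · have hle : ∀ x, ‖gradient (fun x => P x * (1 - Q x)) x‖ ^ N ≤
        2 ^ (N - 1) * (‖fderiv ℝ P x‖ ^ N + ‖fderiv ℝ Q x‖ ^ N) := by
      intro x
      rw [norm_gradient_eq]
      have h1 : fderiv ℝ (fun x => P x * (1 - Q x)) x =
          P x • -fderiv ℝ Q x + (1 - Q x) • fderiv ℝ P x :=
        ((hPd x).hasFDerivAt.mul ((hQd x).hasFDerivAt.const_sub 1)).fderiv
      have h2 : ‖P x • -fderiv ℝ Q x + (1 - Q x) • fderiv ℝ P x‖ ≤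
          ‖fderiv ℝ P x‖ + ‖fderiv ℝ Q x‖ := by
        refine (norm_add_le _ _).trans ?_
        rw [norm_smul, norm_smul, norm_neg, Real.norm_of_nonneg (hP0 x),
          Real.norm_of_nonneg (by linarith [hQ1 x])]
        nlinarith [hP1 x, hQ0 x, norm_nonneg (fderiv ℝ P x), norm_nonneg (fderiv ℝ Q x)]
      rw [h1]
      exact (pow_le_pow_left₀ (norm_nonneg _) h2 N).trans
        (add_pow_le (norm_nonneg _) (norm_nonneg _) N)
    calc _ ≤ ∫ x, 2 ^ (N - 1) * (‖fderiv ℝ P x‖ ^ N + ‖fderiv ℝ Q x‖ ^ N) :=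
          integral_mono_of_nonneg (ae_of_all _ fun x => by positivity)
            (((hintegrable R hR0).add (hintegrable R₀ hR₀)).const_mul _) (ae_of_all _ hle)
      _ = _ := by
          rw [integral_const_mul, integral_add (hintegrable R hR0) (hintegrable R₀ hR₀),
            hscaleI R hR0, hscaleI R₀ hR₀]

/-- An energy estimate with critical weights forces integrability at infinity. -/
lemma integrableOn_pow_of_energy_estimate (hN : 2 ≤ N) {v : EuclideanSpace ℝ (Fin N) → ℝ}
    (hv : Continuous v) (hv0 : ∀ x, 0 ≤ v x) {R₀ δ C : ℝ} (hR₀ : 0 < R₀) (hδ : 0 < δ)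
    (hC : 0 ≤ C)
    (h : ∀ ξ : EuclideanSpace ℝ (Fin N) → ℝ, ContDiff ℝ 1 ξ → HasCompactSupport ξ →
      tsupport ξ ⊆ (Metric.ball 0 R₀)ᶜ →
      ∫ x, δ * v x ^ N * ξ x ^ 2 ≤ ∫ x, C * (v x ^ (N - 2) * ‖gradient ξ x‖ ^ 2)) :
    IntegrableOn (fun x => v x ^ N) (Metric.ball 0 (2 * R₀))ᶜ := by
  obtain ⟨n, rfl⟩ : ∃ n, N = n + 2 := ⟨N - 2, by omega⟩
  obtain ⟨A, hA0, hA⟩ := exists_annulus_cutoff (N := n + 2) (by omega) hR₀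
  set D : ℝ := C * (n + 2 : ℕ) ^ 2 with hD
  have hD0 : 0 ≤ D := by positivity
  obtain ⟨C', hC', hY⟩ := exists_pow_mul_sq_le n (δ := δ / (2 * (D + 1))) (by positivity)
  have hbound : ∀ R : ℝ, 2 * R₀ ≤ R →
      ∫ x in Metric.closedBall 0 R ∩ (Metric.ball 0 (2 * R₀))ᶜ, v x ^ (n + 2) ≤
        2 / δ * (D * C' * A) := by
    intro R hR
    obtain ⟨η, hη, hηs, hηK, hη0, hη1, hηe, hηA⟩ := hA R hR
    have hgη : ∀ x, gradient (fun y => η y ^ (n + 2)) x =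
        ((n + 2 : ℕ) * η x ^ (n + 1)) • gradient η x := by
      intro x
      have h1 : fderiv ℝ (fun y => η y ^ (n + 2)) x = _ :=
        ((hη.differentiable (by norm_num) x).hasFDerivAt.pow (n + 2)).fderiv
      rw [gradient, h1, gradient]
      simp
    have hs : HasCompactSupport fun y => η y ^ (n + 2) :=
      hηs.comp_left (g := fun s : ℝ => s ^ (n + 2)) (by simp)
    have hK : tsupport (fun y => η y ^ (n + 2)) ⊆ (Metric.ball 0 R₀)ᶜ := by
      refine subset_trans (closure_mono ?_) hηK
      intro x hx hx0
      exact hx (by simp [hx0])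
    have hE := h _ (hη.pow (n + 2)) hs hK
    have hcη := hη.continuous
    have hcg := continuous_gradient hη
    have hintegrable : ∀ F : EuclideanSpace ℝ (Fin (n + 2)) → ℝ, Continuous F →
        (∀ x, η x = 0 → gradient η x = 0 → F x = 0) → Integrable F := by
      intro F hF h0
      refine hF.integrable_of_hasCompactSupport (HasCompactSupport.intro hηs fun x hx => ?_)
      exact h0 x (image_eq_zero_of_notMem_tsupport hx) (gradient_eq_zero_of_notMem_tsupport hx)
    have hi1 : Integrable fun x => v x ^ (n + 2) * (η x ^ (n + 2)) ^ 2 :=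
      hintegrable _ ((hv.pow _).mul ((hcη.pow _).pow _)) fun x h0 _ => by simp [h0]
    have hi2 : Integrable fun x => ‖gradient η x‖ ^ (n + 2) :=
      hintegrable _ (hcg.norm.pow _) fun x _ h1 => by simp [h1]
    have hpt : ∀ x, C * (v x ^ (n + 2 - 2) * ‖gradient (fun y => η y ^ (n + 2)) x‖ ^ 2) ≤
        δ / 2 * (v x ^ (n + 2) * (η x ^ (n + 2)) ^ 2) +
          D * C' * ‖gradient η x‖ ^ (n + 2) := by
      intro x
      have hy := hY (v x * η x ^ 2) (η x * ‖gradient η x‖)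
        (mul_nonneg (hv0 x) (sq_nonneg _)) (mul_nonneg (hη0 x) (norm_nonneg _))
      have e1 : C * (v x ^ (n + 2 - 2) * ‖gradient (fun y => η y ^ (n + 2)) x‖ ^ 2) =
          D * ((v x * η x ^ 2) ^ n * (η x * ‖gradient η x‖) ^ 2) := by
        rw [hgη, norm_smul, Real.norm_of_nonneg (mul_nonneg (by positivity) (pow_nonneg (hη0 x) _)),
          hD, Nat.add_sub_cancel]
        ring
      have e2 : (v x * η x ^ 2) ^ (n + 2) = v x ^ (n + 2) * (η x ^ (n + 2)) ^ 2 := by ring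
      have e3 : (η x * ‖gradient η x‖) ^ (n + 2) ≤ ‖gradient η x‖ ^ (n + 2) := by
        refine pow_le_pow_left₀ (mul_nonneg (hη0 x) (norm_nonneg _)) ?_ _
        exact mul_le_of_le_one_left (norm_nonneg _) (hη1 x)
      have e4 : D * (δ / (2 * (D + 1))) ≤ δ / 2 := by
        rw [mul_div_assoc', div_le_div_iff₀ (by positivity) two_pos]
        nlinarith
      have e5 : 0 ≤ v x ^ (n + 2) * (η x ^ (n + 2)) ^ 2 :=
        mul_nonneg (pow_nonneg (hv0 x) _) (sq_nonneg _)
      rw [e2] at hy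
      rw [e1]
      calc _ ≤ D * (δ / (2 * (D + 1)) * (v x ^ (n + 2) * (η x ^ (n + 2)) ^ 2) +
            C' * ‖gradient η x‖ ^ (n + 2)) := by
            gcongr
            exact hy.trans (by gcongr)
        _ = D * (δ / (2 * (D + 1))) * (v x ^ (n + 2) * (η x ^ (n + 2)) ^ 2) +
            D * C' * ‖gradient η x‖ ^ (n + 2) := by ring
        _ ≤ _ := by gcongr
    have hE2 : ∫ x, C * (v x ^ (n + 2 - 2) * ‖gradient (fun y => η y ^ (n + 2)) x‖ ^ 2) ≤
        δ / 2 * (∫ x, v x ^ (n + 2) * (η x ^ (n + 2)) ^ 2) +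
          D * C' * ∫ x, ‖gradient η x‖ ^ (n + 2) := by
      rw [← integral_const_mul, ← integral_const_mul,
        ← integral_add (hi1.const_mul _) (hi2.const_mul _)]
      exact integral_mono_of_nonneg (ae_of_all _ fun x => mul_nonneg hC
        (mul_nonneg (pow_nonneg (hv0 x) _) (sq_nonneg _)))
        ((hi1.const_mul _).add (hi2.const_mul _)) (ae_of_all _ hpt)
    have hE1 : ∫ x, δ * v x ^ (n + 2) * (η x ^ (n + 2)) ^ 2 =
        δ * ∫ x, v x ^ (n + 2) * (η x ^ (n + 2)) ^ 2 := by
      rw [← integral_const_mul]; simp only [mul_assoc]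
    have hfin : ∫ x in Metric.closedBall 0 R ∩ (Metric.ball 0 (2 * R₀))ᶜ, v x ^ (n + 2) ≤
        ∫ x, v x ^ (n + 2) * (η x ^ (n + 2)) ^ 2 := by
      have hms : MeasurableSet (Metric.closedBall (0 : EuclideanSpace ℝ (Fin (n + 2))) R ∩
          (Metric.ball 0 (2 * R₀))ᶜ) :=
        Metric.isClosed_closedBall.measurableSet.inter Metric.isOpen_ball.measurableSet.compl
      rw [setIntegral_congr_fun (g := fun x => v x ^ (n + 2) * (η x ^ (n + 2)) ^ 2) hms ?_]
      · exact setIntegral_le_integral hi1 (ae_of_all _ fun x =>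
          mul_nonneg (pow_nonneg (hv0 x) _) (sq_nonneg _))
      · rintro x ⟨hx1, hx2⟩
        rw [mem_closedBall_zero_iff] at hx1
        rw [Set.mem_compl_iff, mem_ball_zero_iff, not_lt] at hx2
        simp [hηe x hx2 hx1]
    have hAle : D * C' * ∫ x, ‖gradient η x‖ ^ (n + 2) ≤ D * C' * A := by gcongr
    rw [hE1] at hE
    rw [div_mul_eq_mul_div, le_div_iff₀ hδ]
    nlinarith
  refine (aecover_closedBall (x := (0 : EuclideanSpace ℝ (Fin (n + 2))))
    (tendsto_natCast_atTop_atTop (R := ℝ))).integrable_of_integral_bounded_of_nonneg_ae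
      (2 / δ * (D * C' * A)) (fun k => ?_) (ae_of_all _ fun x => pow_nonneg (hv0 x) _) ?_
  · exact ((hv.pow _).continuousOn.integrableOn_compact
      (isCompact_closedBall _ _)).mono_measure Measure.restrict_le_self
  · filter_upwards [tendsto_natCast_atTop_atTop.eventually_ge_atTop (2 * R₀)] with k hk
    rw [Measure.restrict_restrict Metric.isClosed_closedBall.measurableSet]
    exact hbound _ hk

end Cutoff

section Decay

variable {N : ℕ}

lemma exists_setIntegral_compl_ball_lt {w : EuclideanSpace ℝ (Fin N) → ℝ} {R : ℝ}
    (hw : IntegrableOn w (Metric.ball 0 R)ᶜ) (hw0 : ∀ x, 0 ≤ w x) {τ : ℝ} (hτ : 0 < τ) :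
    ∃ R₁, ∀ S ⊆ (Metric.ball (0 : EuclideanSpace ℝ (Fin N)) R₁)ᶜ, ∫ x in S, w x < τ := by
  have hanti : Antitone fun n : ℕ => (Metric.ball (0 : EuclideanSpace ℝ (Fin N)) (R + n))ᶜ :=
    fun m n h => Set.compl_subset_compl.2 (Metric.ball_subset_ball (by gcongr))
  have ht := tendsto_setIntegral_of_antitone (μ := volume) (f := w)
    (fun n : ℕ => Metric.isOpen_ball.measurableSet.compl) hanti ⟨0, by simpa using hw⟩
  have hempty : ⋂ n : ℕ, (Metric.ball (0 : EuclideanSpace ℝ (Fin N)) (R + n))ᶜ = ∅ := by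
    refine Set.eq_empty_of_forall_notMem fun x hx => ?_
    obtain ⟨n, hn⟩ := exists_nat_gt (‖x‖ - R)
    refine Set.mem_iInter.1 hx n ?_
    rw [mem_ball_zero_iff]
    linarith
  rw [hempty, setIntegral_empty] at ht
  obtain ⟨n, hn⟩ := (ht.eventually_lt_const hτ).exists
  refine ⟨R + n, fun S hS => lt_of_le_of_lt ?_ hn⟩
  refine setIntegral_mono_set (hw.mono_set (Set.compl_subset_compl.2
    (Metric.ball_subset_ball (by simp)))) (ae_of_all _ hw0) (LE.le.eventuallyLE hS)

/-- The doubling lemma. -/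
lemma exists_closedBall_forall_le_two_mul {v : EuclideanSpace ℝ (Fin N) → ℝ} (hv : Continuous v)
    (hv0 : ∀ x, 0 < v x) {x : EuclideanSpace ℝ (Fin N)} {r δ : ℝ} (hδ : 0 < δ)
    (h : δ ≤ r * v x) :
    ∃ y, Metric.closedBall y (δ / (2 * v y)) ⊆ Metric.closedBall x r ∧
      ∀ z ∈ Metric.closedBall y (δ / (2 * v y)), v z ≤ 2 * v y := by
  have hr : 0 < r := pos_of_mul_pos_left (hδ.trans_le h) (hv0 x).le
  obtain ⟨y, hy, hmax⟩ := (isCompact_closedBall x r).exists_isMaxOn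
    (Metric.nonempty_closedBall.2 hr.le)
    (f := fun z => (r - dist z x) * v z) (by fun_prop)
  have hyx : δ ≤ (r - dist y x) * v y := by
    have := hmax (Metric.mem_closedBall_self hr.le)
    simp only [Set.mem_ofPred_eq, dist_self, sub_zero] at this
    exact h.trans this
  have hs : δ / (2 * v y) ≤ (r - dist y x) / 2 := by
    rw [div_le_div_iff₀ (mul_pos two_pos (hv0 y)) two_pos]
    linarith
  have hρ : 0 < r - dist y x := pos_of_mul_pos_left (hδ.trans_le hyx) (hv0 y).le
  have hd : ∀ z ∈ Metric.closedBall y (δ / (2 * v y)), dist z x ≤ r - (r - dist y x) / 2 := by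
    intro z hz
    rw [Metric.mem_closedBall] at hz
    linarith [dist_triangle z y x]
  refine ⟨y, fun z hz => ?_, fun z hz => ?_⟩
  · rw [Metric.mem_closedBall]
    linarith [hd z hz]
  · have hz1 := hd z hz
    have hz2 : (r - dist z x) * v z ≤ (r - dist y x) * v y :=
      hmax (Metric.mem_closedBall.2 (by linarith))
    have hz3 : (r - dist y x) / 2 * v z ≤ (r - dist z x) * v z :=
      mul_le_mul_of_nonneg_right (by linarith) (hv0 z).le
    have hz4 : (r - dist y x) / 2 * v z ≤ (r - dist y x) / 2 * (2 * v y) := by linarith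
    exact le_of_mul_le_mul_left hz4 (by linarith)

/-- A lower bound for the critical integral of a supersolution that is not small. -/
lemma exists_le_setIntegral_closedBall (hN : 0 < N) {u : EuclideanSpace ℝ (Fin N) → ℝ}
    (hu : ContDiff ℝ 2 u) (hupos : ∀ x, 0 < u x) {p C δ : ℝ} (hp : 1 < p) (hC : 0 < C)
    (hδ : 0 < δ) (hlap : ∀ x, |lap u x| ≤ C * u x ^ p) :
    ∃ τ : ℝ, 0 < τ ∧ ∀ x r, δ ≤ r * u x ^ ((p - 1) / 2) →
      ∃ S ⊆ Metric.closedBall x r, τ ≤ ∫ z in S, (u z ^ ((p - 1) / 2)) ^ N := by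
  have : Nonempty (Fin N) := ⟨⟨0, hN⟩⟩
  have hN' : (0 : ℝ) < N := by exact_mod_cast hN
  set b := (p - 1) / 2 with hb
  have hb0 : 0 < b := by rw [hb]; linarith
  have hvc : Continuous fun x => u x ^ b :=
    hu.continuous.rpow_const fun x => Or.inl (hupos x).ne'
  have hv0 : ∀ x, 0 < u x ^ b := fun x => Real.rpow_pos_of_pos (hupos x) b
  set L : ℝ := 2 ^ b⁻¹ with hL
  have hL0 : 0 < L := by positivity
  set Λ : ℝ := N * (2 * N * L + (4 * C * L + 1) * δ ^ 2 / 16) with hΛ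
  have hΛ0 : 0 < Λ := by positivity
  set κ : ℝ := min (1 / 2) (1 / (2 * Λ)) with hκ
  have hκ0 : 0 < κ := by positivity
  have hκ1 : κ ≤ 1 / 2 := min_le_left _ _
  have hκ2 : κ * Λ ≤ 1 / 2 := by
    calc κ * Λ ≤ 1 / (2 * Λ) * Λ := by gcongr; exact min_le_right _ _
      _ = 1 / 2 := by field_simp
  set ω : ℝ := volume.real (Metric.ball (0 : EuclideanSpace ℝ (Fin N)) 1) with hω
  have hω0 : 0 < ω :=
    ENNReal.toReal_pos (Metric.measure_ball_pos _ _ one_pos).ne' measure_ball_lt_top.ne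
  refine ⟨((1 / 2) ^ b * (κ * (δ / 2))) ^ N * ω, by positivity, fun x r hx => ?_⟩
  obtain ⟨y, hyS, hy2⟩ := exists_closedBall_forall_le_two_mul hvc hv0 hδ hx
  set V := u y ^ b with hV
  have hVp : 0 < V := hv0 y
  set s := δ / (2 * V) with hs
  have hs0 : 0 < s := by positivity
  have hVs : V * s = δ / 2 := by rw [hs]; field_simp
  have huy := hupos y
  have huL : ∀ z ∈ Metric.closedBall y s, u z ≤ L * u y := by
    intro z hz
    have h1 : (u z ^ b) ^ b⁻¹ ≤ (2 * V) ^ b⁻¹ :=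
      Real.rpow_le_rpow (hv0 z).le (hy2 z hz) (by positivity)
    rwa [Real.rpow_rpow_inv (hupos z).le hb0.ne', Real.mul_rpow two_pos.le hVp.le, hV,
      Real.rpow_rpow_inv huy.le hb0.ne'] at h1
  have hlapF : ∀ z ∈ Metric.closedBall y s, |lap u z| < (4 * C * L + 1) * V ^ 2 * u y := by
    intro z hz
    have h1 : u z ^ p = (u z ^ b) ^ 2 * u z := by
      rw [← Real.rpow_natCast, ← Real.rpow_mul (hupos z).le]
      nth_rewrite 3 [← Real.rpow_one (u z)]
      rw [← Real.rpow_add (hupos z), hb]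
      congr 1; push_cast; ring
    have h2 : (u z ^ b) ^ 2 * u z ≤ (2 * V) ^ 2 * (L * u y) :=
      mul_le_mul (pow_le_pow_left₀ (hv0 z).le (hy2 z hz) 2) (huL z hz) (hupos z).le
        (by positivity)
    have h3 : 0 < V ^ 2 * u y := by positivity
    calc |lap u z| ≤ C * u z ^ p := hlap z
      _ ≤ C * ((2 * V) ^ 2 * (L * u y)) := by rw [h1]; gcongr
      _ < _ := by linarith
  have hgrad : ∀ w ∈ Metric.closedBall y (s / 2), ‖fderiv ℝ u w‖ ≤ Λ * (u y / s) := by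
    intro w hw
    have hsub : Metric.closedBall w (s / 2) ⊆ Metric.closedBall y s := by
      refine Metric.closedBall_subset_closedBall' ?_
      rw [Metric.mem_closedBall] at hw
      linarith
    have := norm_fderiv_le hu (half_pos hs0) (m := L * u y)
      (fun z hz => by rw [abs_of_pos (hupos z)]; exact huL z (hsub hz))
      (fun z hz => hlapF z (hsub hz))
    refine this.trans_eq ?_
    have e : δ = 2 * (V * s) := by linarith
    rw [hΛ, e]
    field_simp
    ring
  have hlow : ∀ z ∈ Metric.closedBall y (κ * s), (1 / 2) ^ b * V ≤ u z ^ b := by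
    intro z hz
    have hκs : κ * s ≤ s / 2 := by nlinarith
    have hmv := (convex_closedBall y (s / 2)).norm_image_sub_le_of_norm_fderiv_le (𝕜 := ℝ)
      (f := u) (fun w _ => hu.differentiable (by norm_num) w) hgrad
      (Metric.closedBall_subset_closedBall hκs hz) (Metric.mem_closedBall_self (by positivity))
    rw [← dist_eq_norm y z, dist_comm] at hmv
    have hz' := Metric.mem_closedBall.1 hz
    have h1 : Λ * (u y / s) * dist z y ≤ u y / 2 := by
      calc Λ * (u y / s) * dist z y ≤ Λ * (u y / s) * (κ * s) := by gcongr
        _ = κ * Λ * u y := by field_simp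
        _ ≤ 1 / 2 * u y := by gcongr
        _ = _ := by ring
    have h2 : 1 / 2 * u y ≤ u z := by
      have := (Real.norm_eq_abs _ ▸ le_abs_self _).trans (hmv.trans h1)
      linarith
    calc (1 / 2) ^ b * V = (1 / 2 * u y) ^ b := by
          rw [hV, Real.mul_rpow (by norm_num) huy.le]
      _ ≤ u z ^ b := Real.rpow_le_rpow (by positivity) h2 hb0.le
  refine ⟨Metric.closedBall y (κ * s), (Metric.closedBall_subset_closedBall ?_).trans hyS, ?_⟩
  · nlinarith
  · calc ((1 / 2) ^ b * (κ * (δ / 2))) ^ N * ω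
        = ∫ z in Metric.closedBall y (κ * s), ((1 / 2) ^ b * V) ^ N := by
          rw [setIntegral_const, measureReal_def, Measure.addHaar_closedBall _ _ (by positivity),
            finrank_euclideanSpace_fin, ENNReal.toReal_mul,
            ENNReal.toReal_ofReal (by positivity), ← measureReal_def, ← hVs, smul_eq_mul]
          ring
      _ ≤ _ := by
          refine setIntegral_mono_on ?_ ?_ Metric.isClosed_closedBall.measurableSet fun z hz => ?_
          · exact continuous_const.continuousOn.integrableOn_compact (isCompact_closedBall _ _)
          · exact (hvc.pow N).continuousOn.integrableOn_compact (isCompact_closedBall _ _)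
          · exact pow_le_pow_left₀ (by positivity) (hlow z hz) N

lemma tendsto_mul_rpow_cocompact (hN : 0 < N) {u : EuclideanSpace ℝ (Fin N) → ℝ}
    (hu : ContDiff ℝ 2 u) (hupos : ∀ x, 0 < u x) {p C R : ℝ} (hp : 1 < p) (hC : 0 < C)
    (hlap : ∀ x, |lap u x| ≤ C * u x ^ p)
    (hintegrable : IntegrableOn (fun x => (u x ^ ((p - 1) / 2)) ^ N) (Metric.ball 0 R)ᶜ) :
    Tendsto (fun x : EuclideanSpace ℝ (Fin N) => u x * ‖x‖ ^ (2 / (p - 1)))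
      (Filter.cocompact _) (𝓝 0) := by
  have hp1 : 0 < p - 1 := by linarith
  have hv : Tendsto (fun x : EuclideanSpace ℝ (Fin N) => ‖x‖ * u x ^ ((p - 1) / 2))
      (Filter.cocompact _) (𝓝 0) := by
    refine Metric.tendsto_nhds.2 fun δ hδ => ?_
    obtain ⟨τ, hτ, hτS⟩ := exists_le_setIntegral_closedBall hN hu hupos hp hC (half_pos hδ) hlap
    obtain ⟨R₁, hR₁⟩ := exists_setIntegral_compl_ball_lt hintegrable
      (fun x => pow_nonneg (Real.rpow_nonneg (hupos x).le _) _) hτ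
    filter_upwards [(tendsto_norm_cocompact_atTop
      (E := EuclideanSpace ℝ (Fin N))).eventually_ge_atTop (2 * R₁)] with x hx
    have hv0 := Real.rpow_pos_of_pos (hupos x) ((p - 1) / 2)
    rw [dist_zero_right, Real.norm_of_nonneg (by positivity)]
    by_contra! hlt
    obtain ⟨S, hS, hSτ⟩ := hτS x (‖x‖ / 2) (by linarith)
    refine (hR₁ S (hS.trans fun z hz => ?_)).not_ge hSτ
    rw [Set.mem_compl_iff, mem_ball_zero_iff, not_lt]
    rw [mem_closedBall_iff_norm] at hz
    have := norm_sub_norm_le x z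
    rw [norm_sub_rev] at this
    linarith
  have hβ : 0 < 2 / (p - 1) := by positivity
  have := hv.rpow_const (p := 2 / (p - 1)) (Or.inr hβ.le)
  rw [Real.zero_rpow hβ.ne'] at this
  refine this.congr fun x => ?_
  rw [Real.mul_rpow (norm_nonneg x) (Real.rpow_nonneg (hupos x).le _),
    ← Real.rpow_mul (hupos x).le, show (p - 1) / 2 * (2 / (p - 1)) = 1 by field_simp,
    Real.rpow_one, mul_comm]

lemma tendsto_norm_gradient_mul_rpow_cocompact (hN : 0 < N)
    {u : EuclideanSpace ℝ (Fin N) → ℝ}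
    (hu : ContDiff ℝ 2 u) (hupos : ∀ x, 0 < u x) {p C : ℝ} (hp : 1 < p) (hC : 0 < C)
    (hlap : ∀ x, |lap u x| ≤ C * u x ^ p)
    (h : Tendsto (fun x : EuclideanSpace ℝ (Fin N) => u x * ‖x‖ ^ (2 / (p - 1)))
      (Filter.cocompact _) (𝓝 0)) :
    Tendsto (fun x : EuclideanSpace ℝ (Fin N) => ‖gradient u x‖ * ‖x‖ ^ (2 / (p - 1) + 1))
      (Filter.cocompact _) (𝓝 0) := by
  have hp1 : 0 < p - 1 := by linarith
  set β := 2 / (p - 1) with hβ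
  have hβ0 : 0 < β := by positivity
  refine Metric.tendsto_nhds.2 fun ε hε => ?_
  obtain ⟨e, he, he0⟩ : ∃ e : ℝ, N * (2 * N * e + C / 2 * e ^ p) < ε ∧ 0 < e := by
    have hc : Continuous fun e : ℝ => N * (2 * N * e + C / 2 * e ^ p) :=
      continuous_const.mul ((continuous_const.mul continuous_id).add
        (continuous_const.mul (Real.continuous_rpow_const (by linarith))))
    have ht := (hc.tendsto 0).mono_left (nhdsWithin_le_nhds (s := Set.Ioi 0))
    rw [mul_zero, Real.zero_rpow (by linarith), mul_zero, add_zero, mul_zero] at ht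
    exact ((ht.eventually_lt_const hε).and self_mem_nhdsWithin).exists
  obtain ⟨R, hR⟩ : ∃ R : ℝ, ∀ y : EuclideanSpace ℝ (Fin N), R ≤ ‖y‖ →
      u y * ‖y‖ ^ β < e / 2 ^ β := by
    have h1 := h.eventually_lt_const (show (0 : ℝ) < e / 2 ^ β by positivity)
    rw [← Metric.cobounded_eq_cocompact, ← comap_norm_atTop, eventually_comap] at h1
    obtain ⟨R, hR⟩ := eventually_atTop.1 h1
    exact ⟨R, fun y hy => hR _ hy y rfl⟩
  filter_upwards [(tendsto_norm_cocompact_atTop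
      (E := EuclideanSpace ℝ (Fin N))).eventually_ge_atTop (2 * R),
    (tendsto_norm_cocompact_atTop (E := EuclideanSpace ℝ (Fin N))).eventually_gt_atTop 0] with x hx hx0
  set r := ‖x‖ with hr
  set m := e * r ^ (-β) with hm
  have hm0 : 0 < m := by positivity
  have hub : ∀ y ∈ Metric.closedBall x (r / 2), u y ≤ m := by
    intro y hy
    have hyr : r / 2 ≤ ‖y‖ := by
      rw [mem_closedBall_iff_norm] at hy
      have := norm_sub_norm_le x y
      rw [norm_sub_rev] at this
      linarith
    have h1 := hR y (by linarith)
    have h2 : u y * (r / 2) ^ β ≤ e / 2 ^ β := by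
      refine le_trans ?_ h1.le
      have := (hupos y).le
      gcongr
    rw [Real.div_rpow hx0.le two_pos.le, mul_div_assoc',
      div_le_div_iff_of_pos_right (by positivity)] at h2
    rw [hm, Real.rpow_neg hx0.le, ← div_eq_mul_inv, le_div_iff₀ (by positivity)]
    exact h2
  have hlapF : ∀ y ∈ Metric.closedBall x (r / 2), |lap u y| < 2 * C * m ^ p := by
    intro y hy
    have h1 : u y ^ p ≤ m ^ p := Real.rpow_le_rpow (hupos y).le (hub y hy) (by linarith)
    have h2 : 0 < C * m ^ p := by positivity
    calc |lap u y| ≤ C * u y ^ p := hlap y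
      _ ≤ C * m ^ p := by gcongr
      _ < _ := by linarith
  have : Nonempty (Fin N) := ⟨⟨0, hN⟩⟩
  have hg := norm_fderiv_le hu (half_pos hx0) (m := m)
    (fun y hy => by rw [abs_of_pos (hupos y)]; exact hub y hy) hlapF
  rw [dist_zero_right, norm_gradient_eq, Real.norm_of_nonneg (by positivity)]
  refine lt_of_le_of_lt ?_ he
  have e1 : m * r ^ β = e := by
    rw [hm, mul_assoc, ← Real.rpow_add hx0, neg_add_cancel, Real.rpow_zero, mul_one]
  have e2 : m ^ p * r ^ (β + 2) = e ^ p := by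
    rw [← e1, Real.mul_rpow hm0.le (by positivity), ← Real.rpow_mul hx0.le]
    congr 2
    rw [hβ]; field_simp; ring
  have e3 : r ^ (β + 1) = r ^ β * r := by rw [Real.rpow_add hx0, Real.rpow_one]
  have e4 : r ^ (β + 2) = r ^ β * r ^ 2 := by
    rw [Real.rpow_add hx0]; norm_num
  calc ‖fderiv ℝ u x‖ * r ^ (β + 1)
      ≤ N * (N * m / (r / 2) + 2 * C * m ^ p * (r / 2) / 2) * r ^ (β + 1) := by gcongr
    _ = N * (2 * N * (m * r ^ β) + C / 2 * (m ^ p * r ^ (β + 2))) := by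
        rw [e3, e4]; field_simp
    _ = _ := by rw [e1, e2]

end Decay

section Nonlinearity

lemma deriv_deriv_nonneg_of_convexOn_Ioi {f : ℝ → ℝ} (hC2 : ContDiffOn ℝ 2 f (Set.Ioi 0))
    (hconv : ConvexOn ℝ (Set.Ioi 0) f) {t : ℝ} (ht : 0 < t) : 0 ≤ deriv (deriv f) t := by
  have hmono := hconv.monotoneOn_deriv fun x hx =>
    (hC2.contDiffAt (Ioi_mem_nhds hx)).differentiableAt (by norm_num)
  have := hmono.derivWithin_nonneg (x := t)
  rwa [derivWithin_of_isOpen isOpen_Ioi ht] at this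

lemma le_mul_deriv_of_convexOn_Ioi {f : ℝ → ℝ} (hcont : ContinuousOn f (Set.Ici 0))
    (hC2 : ContDiffOn ℝ 2 f (Set.Ioi 0)) (hconv : ConvexOn ℝ (Set.Ioi 0) f) (hf0 : f 0 = 0)
    {t : ℝ} (ht : 0 < t) : f t ≤ t * deriv f t := by
  have hlim : Tendsto (fun s => f t - f s - (t - s) * deriv f t) (𝓝[>] 0)
      (𝓝 (f t - 0 - (t - 0) * deriv f t)) := by
    have h0 : Tendsto f (𝓝[>] 0) (𝓝 0) := by
      have := (hcont 0 Set.self_mem_Ici).mono_left (nhdsWithin_mono _ Set.Ioi_subset_Ici_self)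
      rwa [hf0] at this
    have hid : Tendsto (fun s : ℝ => s) (𝓝[>] 0) (𝓝 0) := tendsto_id.mono_left nhdsWithin_le_nhds
    exact (tendsto_const_nhds.sub h0).sub ((tendsto_const_nhds.sub hid).mul_const _)
  have hle : f t - 0 - (t - 0) * deriv f t ≤ 0 := by
    refine le_of_tendsto hlim ?_
    filter_upwards [Ioo_mem_nhdsGT ht] with s hs
    have h1 := hconv.slope_le_deriv (x := s) (y := t) hs.1 ht hs.2
      ((hC2.contDiffAt (Ioi_mem_nhds ht)).differentiableAt (by norm_num))
    rw [slope_def_field, div_le_iff₀ (by linarith [hs.2])] at h1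
    linarith
  linarith

/-- A bound near zero extends to bounded intervals by compactness. -/
lemma exists_mul_le_of_Ioo {h k : ℝ → ℝ} (hh : ContinuousOn h (Set.Ioi 0))
    (hk : ContinuousOn k (Set.Ioi 0)) (hh0 : ∀ t, 0 < t → 0 < h t) (hk0 : ∀ t, 0 < t → 0 < k t)
    {ε c : ℝ} (hε : 0 < ε) (hc : 0 < c) (hle : ∀ t ∈ Set.Ioo 0 ε, c * h t ≤ k t) (M : ℝ) :
    ∃ c', 0 < c' ∧ ∀ t, 0 < t → t ≤ M → c' * h t ≤ k t := by
  have hsub : Set.Icc (ε / 2) (max M (ε / 2)) ⊆ Set.Ioi 0 := fun t ht =>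
    (half_pos hε).trans_le ht.1
  obtain ⟨s, hs, hmin⟩ := isCompact_Icc.exists_isMinOn
    (Set.nonempty_Icc.2 (le_max_right M (ε / 2)))
    ((hk.mono hsub).div (hh.mono hsub) fun t ht => (hh0 t (hsub ht)).ne')
  have hs0 : 0 < s := hsub hs
  refine ⟨min c (k s / h s), lt_min hc (div_pos (hk0 s hs0) (hh0 s hs0)), fun t ht htM => ?_⟩
  have hht := hh0 t ht
  rcases lt_or_ge t ε with h1 | h1
  · exact (mul_le_mul_of_nonneg_right (min_le_left _ _) hht.le).trans (hle t ⟨ht, h1⟩)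
  · have h2 : k s / h s ≤ k t / h t := hmin ⟨by linarith, htM.trans (le_max_left _ _)⟩
    rw [← le_div_iff₀ hht]
    exact (min_le_right _ _).trans h2

end Nonlinearity

/-- Theorem 1.23: refined asymptotics in the supercritical range:
`u(x) = o(|x|^{−2/(p₀−1)})` and `|∇u(x)| = o(|x|^{−2/(p₀−1)−1})` as `|x| → ∞`. -/
theorem stmt12 {N : ℕ} (f : ℝ → ℝ)
    (hcont : ContinuousOn f (Set.Ici 0)) (hC2 : ContDiffOn ℝ 2 f (Set.Ioi 0))
    (hconv : ConvexOn ℝ (Set.Ioi 0) f) (hmono : MonotoneOn f (Set.Ici 0))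
    (hpos : ∀ t : ℝ, 0 < t → 0 < f t) (hf0 : f 0 = 0)
    (q₀ : ℝ≥0∞) (p₀ : ℝ) (hq : Tendsto (qfun f) (𝓝[>] (0:ℝ)) (𝓝 q₀))
    (hpq : 1 / ENNReal.ofReal p₀ + 1 / q₀ = 1)
    (ε c₁ c₂ : ℝ) (hε : 0 < ε) (hc₁ : 0 < c₁) (hc₂ : 0 < c₂)
    (hlower : ∀ t : ℝ, t ∈ Set.Ioo 0 ε → c₁ * t ^ p₀ ≤ f t)
    (hupper : ∀ t : ℝ, t ∈ Set.Ioo 0 ε → deriv f t ≤ c₂ * t ^ (p₀ - 1))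
    (hsup : (3 ≤ N ∧ N ≤ 10 ∧ ((N : ℝ) + 2) / ((N : ℝ) - 2) < p₀) ∨
      (11 ≤ N ∧ ((N : ℝ) + 2) / ((N : ℝ) - 2) < p₀ ∧ p₀ < pc N))
    (u : EuclideanSpace ℝ (Fin N) → ℝ) (hu : ContDiff ℝ 2 u)
    (hbd : ∃ M, ∀ x, |u x| ≤ M) (hupos : ∀ x, 0 < u x)
    (hsol : ∀ x, -lap u x = f (u x))
    (hstab : ∃ K : Set (EuclideanSpace ℝ (Fin N)), IsCompact K ∧
      StableOutside (deriv f) u K) :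
    Tendsto (fun x : EuclideanSpace ℝ (Fin N) => u x * ‖x‖ ^ (2 / (p₀ - 1)))
      (Filter.cocompact (EuclideanSpace ℝ (Fin N))) (𝓝 0) ∧
    Tendsto (fun x : EuclideanSpace ℝ (Fin N) =>
        ‖gradient u x‖ * ‖x‖ ^ (2 / (p₀ - 1) + 1))
      (Filter.cocompact (EuclideanSpace ℝ (Fin N))) (𝓝 0) := by
  obtain ⟨M, hM⟩ := hbd
  obtain ⟨K, hK, hstab⟩ := hstab
  have hN : 3 ≤ N := by omega
  have hS : ((N : ℝ) + 2) / ((N : ℝ) - 2) < p₀ := by tauto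
  obtain ⟨hp, ha⟩ := sobolev_exponent_consequences hN hS
  set a := ((N : ℝ) - 2) * (p₀ - 1) / 4 with ha_def
  obtain ⟨κ, hκ1, hκ2⟩ := exists_between (sq_sub_one_lt_of_supercritical hsup)
  have hκ0 : 0 ≤ κ := (sq_nonneg _).trans hκ1.le
  have hf2 : ∀ t, 0 < t → 0 ≤ deriv (deriv f) t := fun t ht =>
    deriv_deriv_nonneg_of_convexOn_Ioi hC2 hconv ht
  have hlow' : ∀ t, 0 < t → f t ≤ t * deriv f t := fun t ht =>
    le_mul_deriv_of_convexOn_Ioi hcont hC2 hconv hf0 ht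
  obtain ⟨ε', hε', hqε⟩ := (nhdsGT_basis (0 : ℝ)).eventually_iff.1
    (eventually_le_of_tendsto_qfun hq hp hpq hκ0 hκ2 hpos hf2)
  have hfc : ContinuousOn f (Set.Ioi 0) := hC2.continuousOn
  have hf'c : ContinuousOn (deriv f) (Set.Ioi 0) :=
    hC2.continuousOn_deriv_of_isOpen isOpen_Ioi (by norm_num)
  have hpowc : ContinuousOn (fun t : ℝ => t ^ p₀) (Set.Ioi 0) :=
    continuousOn_id.rpow_const fun t ht => Or.inl (ne_of_gt ht)
  have hpow0 : ∀ t : ℝ, 0 < t → 0 < t ^ p₀ := fun t ht => Real.rpow_pos_of_pos ht _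
  have htf' : ∀ t ∈ Set.Ioo 0 ε, t * deriv f t ≤ c₂ * t ^ p₀ := by
    intro t ht
    calc t * deriv f t ≤ t * (c₂ * t ^ (p₀ - 1)) :=
          mul_le_mul_of_nonneg_left (hupper t ht) ht.1.le
      _ = c₂ * t ^ p₀ := by
          rw [Real.rpow_sub_one ht.1.ne']
          have := ht.1.ne'
          field_simp
  obtain ⟨k₁, hk₁, hb₁⟩ := exists_mul_le_of_Ioo hpowc hfc hpow0 hpos hε hc₁ hlower M
  obtain ⟨k₂, hk₂, hb₂⟩ := exists_mul_le_of_Ioo hfc hpowc hpos hpow0 hε (inv_pos.2 hc₂)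
    (fun t ht => by
      rw [inv_mul_le_iff₀ hc₂]
      exact (hlow' t ht.1).trans (htf' t ht)) M
  obtain ⟨k₃, hk₃, hb₃⟩ := exists_mul_le_of_Ioo (continuousOn_id.mul hf'c) hfc
    (fun t ht => (hpos t ht).trans_le (hlow' t ht)) hpos hε (div_pos hc₁ hc₂)
    (fun t ht => by
      rw [div_mul_eq_mul_div, div_le_iff₀ hc₂]
      calc c₁ * (t * deriv f t) ≤ c₁ * (c₂ * t ^ p₀) :=
            mul_le_mul_of_nonneg_left (htf' t ht) hc₁.le
        _ = c₁ * t ^ p₀ * c₂ := by ring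
        _ ≤ f t * c₂ := by gcongr; exact hlower t ht) M
  set C := max k₂⁻¹ k₃⁻¹ with hC_def
  have hC : 0 < C := lt_max_of_lt_left (inv_pos.2 hk₂)
  have hupp : ∀ t, 0 < t → t ≤ M → f t ≤ C * t ^ p₀ := by
    intro t ht htM
    have h1 := hb₂ t ht htM
    rw [← le_inv_mul_iff₀ hk₂] at h1
    exact h1.trans (mul_le_mul_of_nonneg_right (le_max_left _ _) (hpow0 t ht).le)
  have hupp' : ∀ t, 0 < t → t ≤ M → t * deriv f t ≤ C * f t := by
    intro t ht htM
    have h1 := hb₃ t ht htM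
    rw [← le_inv_mul_iff₀ hk₃] at h1
    exact h1.trans (mul_le_mul_of_nonneg_right (le_max_right _ _) (hpos t ht).le)
  have huM : ∀ x, u x ≤ M := fun x => (le_abs_self _).trans (hM x)
  obtain ⟨g, g', G, G', δ, B, hδ, hB, hg, hG, hg', hG', hgG⟩ := exists_test_functions hp ha hκ1
    hε' hC2 hpos hf2 (fun t ht htε => hqε ⟨ht, htε⟩) hk₁ hC hb₁ hupp
    (fun t ht _ => hlow' t ht) hupp'
  obtain ⟨R₀, hR₀, hKR₀⟩ := hK.isBounded.subset_ball_lt 0 0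
  have hN2 : ((N - 2 : ℕ) : ℝ) = (N : ℝ) - 2 := by rw [Nat.cast_sub (by omega)]; norm_num
  have hw : ∀ x, (u x * u x ^ (a - 1)) ^ 2 = (u x ^ ((p₀ - 1) / 2)) ^ (N - 2) := by
    intro x
    rw [Real.rpow_sub_one (hupos x).ne', mul_div_cancel₀ _ (hupos x).ne', ← Real.rpow_natCast,
      ← Real.rpow_natCast, ← Real.rpow_mul (hupos x).le, ← Real.rpow_mul (hupos x).le, hN2,
      ha_def]
    congr 1
    push_cast
    ring
  have hw' : ∀ x, u x ^ (p₀ - 1) * (u x * u x ^ (a - 1)) ^ 2 = (u x ^ ((p₀ - 1) / 2)) ^ N := by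
    intro x
    have h1 : (u x ^ ((p₀ - 1) / 2)) ^ 2 = u x ^ (p₀ - 1) := by
      rw [← Real.rpow_mul_natCast (hupos x).le]
      congr 1
      push_cast
      ring
    rw [hw, ← pow_sub_mul_pow _ (show 2 ≤ N by omega), h1, mul_comm]
  have hlap : ∀ x, |lap u x| ≤ C * u x ^ p₀ := by
    intro x
    rw [← abs_neg, hsol, abs_of_pos (hpos _ (hupos x))]
    exact hupp _ (hupos x) (huM x)
  have hintegrable := integrableOn_pow_of_energy_estimate (by omega)
    (v := fun x => u x ^ ((p₀ - 1) / 2))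
    (hu.continuous.rpow_const fun x => Or.inl (hupos x).ne')
    (fun x => Real.rpow_nonneg (hupos x).le _) hR₀ hδ
    (show 0 ≤ B ^ 2 / δ + B ^ 2 by positivity)
    (fun ξ hξ hξs hξK => by
      have h1 := energy_estimate hδ hu hupos huM hsol hstab hfc hf'c hg hG hg' hG' hgG hξ hξs
        (hξK.trans (Set.compl_subset_compl.2 hKR₀))
      simp only [mul_assoc δ, hw'] at h1
      simpa only [hw, mul_assoc δ] using h1)
  have hdecay := tendsto_mul_rpow_cocompact (by omega) hu hupos hp hC hlap hintegrable
  exact ⟨hdecay, tendsto_norm_gradient_mul_rpow_cocompact (by omega) hu hupos hp hC hlap hdecay⟩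
end
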